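/- arXiv:0901.2453 — 4 statements merged into one kernel-verified Lean document; each statement's English description precedes it below -/
import Mathlib

section
/- Let P be phi-irreducible and aperiodic. Assume there exist measurable functions W : X → [1,∞) and n : X → {1,2,…}, constants β ∈ (0,1) and b < ∞, and a small set C with sup_{x∈C} W(x) < ∞ such that P^{n(x)} W(x) ≤ β W(x) + b·1_C(x) for all x ∈ X. Let R : (0,∞) → (0,∞) be a strictly increasing function such that (R(n))_{n∈ℕ} is a subgeometric rate sequence, and such that either (i) t ↦ R(t)/t is non-increasing and R(n(x)) ≤ W(x) for all x, or (ii) R is a convex continuously differentiable bijection of (0,∞) onto (0,∞) with log-concave derivative and R⁻¹(W(x)) − R⁻¹(β W(x)) ≥ n(x) for all x. If moreover P admits a unique invariant probability measure π with ∫ W dπ < ∞, then there exists an accessible small set D such that sup_{x∈D} 𝔼_x[∑_{k=0}^{τ_D − 1} R(k)] < ∞. -/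
open MeasureTheory ProbabilityTheory ENNReal Set Filter

variable {X : Type*} [MeasurableSpace X]

/-- The `n`-step transition kernel `P^n`. -/
noncomputable def kernelIter (P : Kernel X X) : ℕ → Kernel X X
  | 0 => Kernel.id
  | n + 1 => (kernelIter P n) ∘ₖ P

instance kernelIter.instIsMarkovKernel (P : Kernel X X) [IsMarkovKernel P] (n : ℕ) :
    IsMarkovKernel (kernelIter P n) := by
  induction n with
  | zero => rw [kernelIter]; infer_instance
  | succ n ih => rw [kernelIter]; exact Kernel.IsMarkovKernel.comp _ _

/-- `P^n f (x) = ∫ P^n(x, dy) f(y)` for a nonnegative (real-valued) function `f`. -/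
noncomputable def kernelExp (μ : Measure X) (f : X → ℝ) : ℝ≥0∞ :=
  ∫⁻ y, ENNReal.ofReal (f y) ∂μ

/-- The `f`-norm `‖μ - ν‖_f = ∫ f d|μ - ν|` of the difference of two finite measures. -/
noncomputable def fNorm (μ ν : Measure X) [IsFiniteMeasure μ] [IsFiniteMeasure ν]
    (f : X → ℝ) : ℝ≥0∞ :=
  ∫⁻ x, ENNReal.ofReal (f x) ∂((μ.toSignedMeasure - ν.toSignedMeasure).totalVariation)

/-- `retTaboo P C f n x = 𝔼ₓ[f(Φₙ) 1_{Φ₁ ∉ C, …, Φₙ ∉ C}] = 𝔼ₓ[f(Φₙ) 1_{τ_C > n}]`,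
where `τ_C` is the first return time to `C`. -/
noncomputable def retTaboo (P : Kernel X X) (C : Set X) (f : X → ℝ≥0∞) : ℕ → X → ℝ≥0∞
  | 0 => f
  | n + 1 => fun x => ∫⁻ y, Cᶜ.indicator (retTaboo P C f n) y ∂(P x)

/-- `survival P C n x = ℙₓ(τ_C > n)` where `τ_C := inf {n ≥ 1 : Φₙ ∈ C}`. -/
noncomputable def survival (P : Kernel X X) (C : Set X) (n : ℕ) (x : X) : ℝ≥0∞ :=
  retTaboo P C (fun _ => 1) n x

/-- `𝔼ₓ[R(τ_C)]` for `R : ℕ → ℝ≥0∞`, where `τ_C := inf {n ≥ 1 : Φₙ ∈ C}` is the first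
return time to `C`, with the convention `R(∞) = lim_n R(n) = ⨆ n, R(n+1)`
(the event `{τ_C = ∞}` has probability `⨅ n, ℙₓ(τ_C > n)`). -/
noncomputable def expReturn (P : Kernel X X) (C : Set X) (R : ℕ → ℝ≥0∞) (x : X) : ℝ≥0∞ :=
  (∑' n, R (n + 1) * (survival P C n x - survival P C (n + 1) x))
    + (⨆ n, R (n + 1)) * ⨅ n, survival P C n x

/-- `hitTaboo P C f n x = 𝔼ₓ[f(Φₙ) 1_{Φ₀ ∉ C, …, Φ_{n-1} ∉ C}] = 𝔼ₓ[f(Φₙ) 1_{σ_C ≥ n}]`,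
where `σ_C := inf {n ≥ 0 : Φₙ ∈ C}` is the hitting time of `C`. -/
noncomputable def hitTaboo (P : Kernel X X) (C : Set X) (f : X → ℝ≥0∞) : ℕ → X → ℝ≥0∞
  | 0 => f
  | n + 1 => fun x => Cᶜ.indicator (fun x' => ∫⁻ y, hitTaboo P C f n y ∂(P x')) x

/-- `hitSurvival P C n x = ℙₓ(σ_C ≥ n)` where `σ_C := inf {n ≥ 0 : Φₙ ∈ C}`. -/
noncomputable def hitSurvival (P : Kernel X X) (C : Set X) (n : ℕ) (x : X) : ℝ≥0∞ :=
  hitTaboo P C (fun _ => 1) n x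

/-- A set `C` is small for the kernel `P`: `P(x, ·) ≥ ε ν(·)` for all `x ∈ C`,
for some `ε > 0` and nontrivial measure `ν`. -/
def IsSmallSet (P : Kernel X X) (C : Set X) : Prop :=
  ∃ (ε : ℝ) (ν : Measure X), 0 < ε ∧ ν ≠ 0 ∧
    ∀ x ∈ C, ∀ A : Set X, MeasurableSet A → ENNReal.ofReal ε * ν A ≤ P x A

/-- `P` is phi-irreducible. -/
def KIrreducible (P : Kernel X X) : Prop :=
  ∃ φ : Measure X, φ ≠ 0 ∧ SigmaFinite φ ∧
    ∀ A : Set X, MeasurableSet A → 0 < φ A → ∀ x : X, ∃ n, 1 ≤ n ∧ 0 < kernelIter P n x A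

/-- `P` is aperiodic: there is a small set `C₀` with small-set measure `ν`, `ν C₀ > 0`, such
that the set `{n ≥ 1 : ∃ δ > 0, ∀ x ∈ C₀, P^n(x,·) ≥ δ ν(·)}` has gcd `1` (i.e. every common
divisor of this set equals `1`). -/
def KAperiodic (P : Kernel X X) : Prop :=
  ∃ (C₀ : Set X) (ν : Measure X) (ε : ℝ), MeasurableSet C₀ ∧ 0 < ε ∧ ν ≠ 0 ∧
    (∀ x ∈ C₀, ∀ A : Set X, MeasurableSet A → ENNReal.ofReal ε * ν A ≤ P x A) ∧
    0 < ν C₀ ∧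
    ∀ d : ℕ,
      (∀ n, 1 ≤ n →
        (∃ δ : ℝ, 0 < δ ∧ ∀ x ∈ C₀, ∀ A : Set X, MeasurableSet A →
            ENNReal.ofReal δ * ν A ≤ kernelIter P n x A) → d ∣ n) → d = 1

/-- A set `D` is accessible for `P`. -/
def Accessible (P : Kernel X X) (D : Set X) : Prop :=
  ∀ x : X, ∃ n, 1 ≤ n ∧ 0 < kernelIter P n x D

/-- The class `Λ` of subgeometric rate sequences. -/
def SubgeometricRate (r : ℕ → ℝ) : Prop :=
  (∀ n, 0 ≤ r n) ∧ Monotone r ∧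
    ∃ r₀ : ℕ → ℝ, 1 ≤ r₀ 0 ∧ Monotone r₀ ∧
      (∀ m n : ℕ, 1 ≤ m → m ≤ n → Real.log (r₀ n) / n ≤ Real.log (r₀ m) / m) ∧
      Tendsto (fun n => Real.log (r₀ n) / n) atTop (nhds 0) ∧
      Tendsto (fun n => r n / r₀ n) atTop (nhds 1)

section KernelIter

variable {P K A B : Kernel X X}

theorem lintegral_kernelIter_zero (P : Kernel X X) {f : X → ℝ≥0∞} (hf : Measurable f) (x : X) :
    ∫⁻ y, f y ∂kernelIter P 0 x = f x := by
  simp [kernelIter, Kernel.id_apply, lintegral_dirac' x hf]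

theorem lintegral_kernelIter_succ (P : Kernel X X) (k : ℕ) {f : X → ℝ≥0∞} (hf : Measurable f)
    (x : X) :
    ∫⁻ y, f y ∂kernelIter P (k + 1) x = ∫⁻ y, ∫⁻ z, f z ∂kernelIter P k y ∂P x := by
  rw [kernelIter, Kernel.lintegral_comp _ _ _ hf]

theorem lintegral_kernelIter_add (P : Kernel X X) (j k : ℕ) {f : X → ℝ≥0∞} (hf : Measurable f)
    (x : X) :
    ∫⁻ y, f y ∂kernelIter P (j + k) x = ∫⁻ y, ∫⁻ z, f z ∂kernelIter P k y ∂kernelIter P j x := by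
  induction j generalizing x with
  | zero => rw [zero_add, lintegral_kernelIter_zero _ hf.lintegral_kernel]
  | succ j ih =>
    rw [Nat.add_right_comm, lintegral_kernelIter_succ _ _ hf,
      lintegral_kernelIter_succ _ _ hf.lintegral_kernel]
    exact lintegral_congr ih

theorem kernelIter_apply_univ (P : Kernel X X) (k : ℕ) (x : X) :
    kernelIter P k x univ = ∫⁻ _, 1 ∂kernelIter P k x := by
  simp

theorem kernelIter_add_apply (P : Kernel X X) (j k : ℕ) {s : Set X} (hs : MeasurableSet s) (x : X) :
    kernelIter P (j + k) x s = ∫⁻ y, kernelIter P k y s ∂kernelIter P j x := by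
  simp only [← lintegral_indicator_one hs]
  exact lintegral_kernelIter_add P j k (measurable_one.indicator hs) x

theorem kernelIter_add_apply_univ (P : Kernel X X) (j k : ℕ) (x : X) :
    kernelIter P (j + k) x univ = ∫⁻ y, kernelIter P k y univ ∂kernelIter P j x :=
  kernelIter_add_apply P j k .univ x

theorem kernelIter_one (P : Kernel X X) : kernelIter P 1 = P := by
  simp [kernelIter]

theorem kernelIter_zero_apply (P : Kernel X X) {s : Set X} (hs : MeasurableSet s) (x : X) :
    kernelIter P 0 x s = s.indicator 1 x := by
  rw [kernelIter, Kernel.id_apply, Measure.dirac_apply' x hs]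

theorem kernelIter_succ_apply (P : Kernel X X) (k : ℕ) {s : Set X} (hs : MeasurableSet s) (x : X) :
    kernelIter P (k + 1) x s = ∫⁻ y, kernelIter P k y s ∂P x := by
  rw [kernelIter, Kernel.comp_apply' _ _ _ hs]

theorem kernelIter_mono (h : ∀ x, K x ≤ P x) (k : ℕ) (x : X) :
    kernelIter K k x ≤ kernelIter P k x := by
  induction k generalizing x with
  | zero => simp [kernelIter]
  | succ k ih =>
    refine Measure.le_iff.2 fun s hs => ?_
    rw [kernelIter, kernelIter, Kernel.comp_apply' _ _ _ hs, Kernel.comp_apply' _ _ _ hs]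
    exact lintegral_mono' (h x) fun y => ih y s

theorem kernelIter_univ_le_one [IsMarkovKernel P] (h : ∀ x, K x ≤ P x) (k : ℕ) (x : X) :
    kernelIter K k x univ ≤ 1 :=
  (kernelIter_mono h k x univ).trans prob_le_one

theorem kernelIter_univ_antitone [IsMarkovKernel P] (h : ∀ x, K x ≤ P x) (x : X) :
    Antitone fun k => kernelIter K k x univ := by
  refine antitone_nat_of_succ_le fun k => ?_
  rw [kernelIter_add_apply_univ]
  calc ∫⁻ y, kernelIter K 1 y univ ∂kernelIter K k x
      ≤ ∫⁻ _, 1 ∂kernelIter K k x := lintegral_mono fun y => kernelIter_univ_le_one h 1 y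
    _ = _ := by simp

/-- Integrating a function bounded below by `c` against the two kernels `K^k ≤ P^k`. -/
theorem lintegral_kernelIter_add_const_le [IsMarkovKernel P] (h : ∀ x, K x ≤ P x) (k : ℕ) (x : X)
    {g : X → ℝ≥0∞} {c : ℝ≥0∞} (hc : ∀ y, c ≤ g y) :
    ∫⁻ y, g y ∂kernelIter K k x + c ≤
      ∫⁻ y, g y ∂kernelIter P k x + c * kernelIter K k x univ := by
  have hg : g = fun y => c + (g y - c) := by
    ext y; rw [add_tsub_cancel_of_le (hc y)]
  rw [hg, lintegral_add_left measurable_const, lintegral_add_left measurable_const]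
  simp only [lintegral_const, measure_univ, mul_one]
  have := lintegral_mono' (kernelIter_mono h k x) (le_refl fun y => g y - c)
  calc _ ≤ c * kernelIter K k x univ + ∫⁻ y, g y - c ∂kernelIter P k x + c := by gcongr
    _ = _ := by ring

/-- The `k`-step kernel of the chain killed on `D` gives the survival probabilities. -/
theorem survival_eq_kernelIter (P : Kernel X X) {D : Set X} (hD : MeasurableSet D) (k : ℕ) (x : X) :
    survival P D k x = kernelIter (P.restrict hD.compl) k x univ := by
  induction k generalizing x with
  | zero => simp [survival, retTaboo, kernelIter]
  | succ k ih =>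
    rw [kernelIter_apply_univ, lintegral_kernelIter_succ _ _ measurable_const,
      Kernel.lintegral_restrict, ← lintegral_indicator hD.compl]
    refine lintegral_congr fun y => ?_
    by_cases hy : y ∈ Dᶜ
    · simpa [hy, survival] using ih y
    · simp [hy]

theorem lintegral_kernelIter_of_invariant {π : Measure X} (hπ : Kernel.Invariant P π)
    {f : X → ℝ≥0∞} (hf : Measurable f) : ∫⁻ x, ∫⁻ y, f y ∂P x ∂π = ∫⁻ x, f x ∂π := by
  conv_rhs => rw [← hπ.def]
  rw [Measure.lintegral_bind P.aemeasurable hf.aemeasurable]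

theorem lintegral_add_indicator_const {C : Set X} {m : Measure X}
    (hA : ∀ x, A x = B x + C.indicator (fun _ => m) x) (f : X → ℝ≥0∞) (x : X) :
    ∫⁻ y, f y ∂A x = ∫⁻ y, f y ∂B x + C.indicator 1 x * ∫⁻ y, f y ∂m := by
  rw [hA, lintegral_add_measure]
  by_cases hx : x ∈ C <;> simp [hx]

/-- Decomposition of the killed chain at the successive regenerations. -/
theorem kernelIter_univ_renewal {C : Set X} (hC : MeasurableSet C) {m : Measure X}
    (hA : ∀ x, A x = B x + C.indicator (fun _ => m) x) (k : ℕ) (x : X) :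
    kernelIter A (k + 1) x univ = kernelIter B (k + 1) x univ +
      ∑ p ∈ Finset.HasAntidiagonal.antidiagonal k,
        kernelIter B p.1 x C * ∫⁻ y, kernelIter A p.2 y univ ∂m := by
  have hmeas : ∀ (Q : Kernel X X) (j : ℕ) (s : Set X), MeasurableSet s →
      Measurable fun y => kernelIter Q j y s := fun Q j s hs => Kernel.measurable_coe _ hs
  induction k generalizing x with
  | zero =>
    simp only [kernelIter_one, zero_add, Finset.Nat.antidiagonal_zero, Finset.sum_singleton,
      kernelIter_zero_apply _ hC, kernelIter_zero_apply _ .univ]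
    rw [hA x]
    by_cases hx : x ∈ C <;> simp [hx]
  | succ k ih =>
    rw [kernelIter_succ_apply _ _ .univ, kernelIter_succ_apply _ (k + 1) .univ,
      lintegral_add_indicator_const hA, lintegral_congr ih,
      lintegral_add_left (hmeas _ _ _ .univ), add_assoc]
    congr 1
    rw [Finset.Nat.sum_antidiagonal_succ, add_comm, lintegral_finsetSum]
    · congr 1
      · rw [kernelIter_zero_apply _ hC]
      · refine Finset.sum_congr rfl fun p _ => ?_
        rw [lintegral_mul_const _ (hmeas _ _ _ hC), kernelIter_succ_apply _ _ hC]
    · exact fun p _ => (hmeas _ _ _ hC).mul_const _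

end KernelIter

section RegenerationTime

variable {P K : Kernel X X}

theorem sum_range_tsub_of_monotone {r : ℕ → ℝ≥0∞} (hr : Monotone r) (s k : ℕ) :
    r s + ∑ m ∈ Finset.range k, (r (s + m + 1) - r (s + m)) = r (s + k) := by
  induction k with
  | zero => simp
  | succ k ih =>
    rw [Finset.sum_range_succ, ← add_assoc, ih, ← add_assoc s k 1,
      add_tsub_cancel_of_le (hr (Nat.le_succ _))]

/-- The truncated moment `𝔼ₓ[r(s + T ∧ j)]` of the lifetime `T` of the chain with sub-Markov
kernel `K`. -/
noncomputable def lifetimeMoment (K : Kernel X X) (r : ℕ → ℝ≥0∞) (j s : ℕ) (x : X) : ℝ≥0∞ :=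
  r s + ∑ m ∈ Finset.range j, (r (s + m + 1) - r (s + m)) * kernelIter K m x univ

theorem lifetimeMoment_le [IsMarkovKernel P] (h : ∀ x, K x ≤ P x) {r : ℕ → ℝ≥0∞}
    (hr : Monotone r) (j s : ℕ) (x : X) : lifetimeMoment K r j s x ≤ r (s + j) := by
  rw [← sum_range_tsub_of_monotone hr, lifetimeMoment]
  gcongr with m _
  exact mul_le_of_le_one_right' (kernelIter_univ_le_one h m x)

theorem lifetimeMoment_add_le [IsMarkovKernel P] (h : ∀ x, K x ≤ P x) {r : ℕ → ℝ≥0∞}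
    (hr : Monotone r) (j s k : ℕ) (x : X) :
    lifetimeMoment K r j s x + r (s + k) * kernelIter K k x univ ≤
      r (s + k) + ∫⁻ y, lifetimeMoment K r (j - k) (s + k) y ∂kernelIter K k x := by
  have hint : ∫⁻ y, lifetimeMoment K r (j - k) (s + k) y ∂kernelIter K k x =
      r (s + k) * kernelIter K k x univ + ∑ m ∈ Finset.range (j - k),
        (r (s + k + m + 1) - r (s + k + m)) * kernelIter K (k + m) x univ := by
    simp only [lifetimeMoment]
    rw [lintegral_add_left measurable_const, lintegral_const, lintegral_finsetSum]
    · congr 1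
      refine Finset.sum_congr rfl fun m _ => ?_
      rw [lintegral_const_mul _ (Kernel.measurable_coe _ .univ), kernelIter_add_apply_univ]
    · exact fun m _ => (Kernel.measurable_coe _ .univ).const_mul _
  rw [hint]
  rcases le_total j k with hjk | hkj
  · rw [Nat.sub_eq_zero_of_le hjk, Finset.range_zero, Finset.sum_empty, add_zero]
    gcongr
    exact (lifetimeMoment_le h hr j s x).trans (hr (by lia))
  · obtain ⟨i, rfl⟩ := Nat.exists_eq_add_of_le hkj
    have hk : lifetimeMoment K r (k + i) s x = lifetimeMoment K r k s x +
        ∑ m ∈ Finset.range i,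
          (r (s + k + m + 1) - r (s + k + m)) * kernelIter K (k + m) x univ := by
      simp only [lifetimeMoment, Finset.sum_range_add, add_assoc]
    rw [hk, Nat.add_sub_cancel_left]
    have := lifetimeMoment_le h hr k s x
    calc _ ≤ r (s + k) + (∑ m ∈ Finset.range i,
          (r (s + k + m + 1) - r (s + k + m)) * kernelIter K (k + m) x univ) +
            r (s + k) * kernelIter K k x univ := by gcongr
      _ = _ := by ring

/-- A state-dependent drift condition towards a set `C` on which the kernel `K` loses mass bounds
the moments of the lifetime. -/
theorem lifetimeMoment_le_of_drift [IsMarkovKernel P] (h : ∀ x, K x ≤ P x) {r : ℕ → ℝ≥0∞}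
    (hr : Monotone r) (hrtop : ∀ k, r k ≠ ⊤) {C : Set X} {n : X → ℕ} (hn1 : ∀ x, 1 ≤ n x)
    {e L : ℝ≥0∞} (he0 : e ≠ 0) (hetop : e ≠ ⊤) (hL : L ≠ ⊤)
    (he : ∀ x ∈ C, K x univ + e ≤ 1) {G : ℕ → X → ℝ≥0∞} (hGr : ∀ s x, r s ≤ G s x)
    (hG : ∀ s, ∀ x ∉ C, ∫⁻ y, G (s + n x) y ∂kernelIter P (n x) x ≤ G s x)
    (hGC : ∀ s, ∀ x ∈ C, 2 * ∫⁻ y, G (s + n x) y ∂kernelIter P (n x) x ≤ (2 + e) * r s + L)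
    (j s : ℕ) (x : X) :
    lifetimeMoment K r j s x ≤ 2 * G s x + L / e := by
  induction j using Nat.strong_induction_on generalizing s x with
  | _ j ih =>
    rcases Nat.eq_zero_or_pos j with rfl | hj
    · rw [lifetimeMoment, Finset.range_zero, Finset.sum_empty, add_zero]
      calc r s ≤ G s x := hGr s x
        _ ≤ 2 * G s x := le_mul_of_one_le_left' (by norm_num)
        _ ≤ _ := le_self_add
    set k := n x
    set q := kernelIter K k x univ with hq
    set κ := L / e with hκ
    set p := ∫⁻ y, G (s + k) y ∂kernelIter P k x with hp
    set g := ∫⁻ y, G (s + k) y ∂kernelIter K k x with hg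
    set b := lifetimeMoment K r j s x
    have hκe : κ * e = L := ENNReal.div_mul_cancel he0 hetop
    have hκtop : κ ≠ ⊤ := ENNReal.div_ne_top hL he0
    have hq1 : q ≤ 1 := kernelIter_univ_le_one h k x
    have hqtop : q ≠ ⊤ := (hq1.trans_lt one_lt_top).ne
    have h1 : b + r (s + k) * q ≤ r (s + k) + (2 * g + κ * q) := by
      refine (lifetimeMoment_add_le h hr j s k x).trans ?_
      gcongr
      calc _ ≤ ∫⁻ y, 2 * G (s + k) y + κ ∂kernelIter K k x :=
            lintegral_mono fun y => ih (j - k) (by have := hn1 x; lia) (s + k) y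
        _ = _ := by
            rw [lintegral_add_right _ measurable_const, lintegral_const_mul' _ _ (by norm_num),
              lintegral_const]
    have h2 : g + r (s + k) ≤ p + r (s + k) * q :=
      lintegral_kernelIter_add_const_le h k x fun y => hGr _ y
    have h3 : b + r (s + k) ≤ 2 * p + r (s + k) * q + κ * q := by
      have hfin : r (s + k) * q + r (s + k) ≠ ⊤ := by
        simp [hrtop, ENNReal.mul_eq_top, hqtop]
      refine (ENNReal.add_le_add_iff_right hfin).1 ?_
      calc b + r (s + k) + (r (s + k) * q + r (s + k))
          = (b + r (s + k) * q) + 2 * r (s + k) := by ring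
        _ ≤ r (s + k) + (2 * g + κ * q) + 2 * r (s + k) := by gcongr
        _ = 2 * (g + r (s + k)) + (κ * q + r (s + k)) := by ring
        _ ≤ 2 * (p + r (s + k) * q) + (κ * q + r (s + k)) := by gcongr
        _ = _ := by ring
    by_cases hx : x ∈ C
    · have hqe : q + e ≤ 1 := by
        refine le_trans ?_ (he x hx)
        gcongr
        have := kernelIter_univ_antitone h x (hn1 x)
        simpa only [kernelIter_one] using this
      have hrs : r s ≤ r (s + k) := hr (Nat.le_add_right s k)
      have hfin : r (s + k) + e * r (s + k) + L ≠ ⊤ := by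
        simp [hrtop, ENNReal.mul_eq_top, hL, hetop]
      have h4 : b ≤ 2 * r s + κ := by
        refine (ENNReal.add_le_add_iff_right hfin).1 ?_
        calc b + (r (s + k) + e * r (s + k) + L)
            = (b + r (s + k)) + (e * r (s + k) + κ * e) := by rw [hκe]; ring
          _ ≤ (2 * p + r (s + k) * q + κ * q) + (e * r (s + k) + κ * e) := by gcongr
          _ = 2 * p + r (s + k) * (q + e) + κ * (q + e) := by ring
          _ ≤ ((2 + e) * r s + L) + r (s + k) * 1 + κ * 1 := by
              gcongr
              exact hGC s x hx
          _ = (2 * r s + κ) + (r (s + k) + e * r s + L) := by ring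
          _ ≤ _ := by gcongr
      exact h4.trans (by gcongr; exact hGr s x)
    · refine (ENNReal.add_le_add_iff_right (hrtop (s + k))).1 ?_
      calc b + r (s + k) ≤ 2 * p + r (s + k) * q + κ * q := h3
        _ ≤ 2 * G s x + r (s + k) * 1 + κ * 1 := by
            gcongr
            exact hG s x hx
        _ = _ := by ring

end RegenerationTime

section Occupation

variable {P K : Kernel X X}

theorem ENNReal.tsum_tsum_eq_tsum_sum_antidiagonal (F : ℕ → ℕ → ℝ≥0∞) :
    ∑' i, ∑' j, F i j = ∑' k, ∑ p ∈ Finset.HasAntidiagonal.antidiagonal k, F p.1 p.2 := by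
  rw [← ENNReal.tsum_prod, ← Finset.HasAntidiagonal.sigmaAntidiagonalEquivProd.tsum_eq,
    ENNReal.tsum_sigma']
  refine tsum_congr fun k => ?_
  rw [tsum_fintype, Finset.univ_eq_attach, ← Finset.sum_attach _ fun p : ℕ × ℕ => F p.1 p.2]
  rfl

/-- An invariant measure dominates the occupation measure of a cycle between regenerations. -/
theorem mul_tsum_lintegral_kernelIter_le {C : Set X} (hC : MeasurableSet C) {μ π : Measure X}
    (hP : ∀ x, P x = K x + C.indicator (fun _ => μ) x) (hπ : Kernel.Invariant P π)
    {f : X → ℝ≥0∞} (hf : Measurable f) :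
    π C * ∑' j, ∫⁻ y, ∫⁻ z, f z ∂kernelIter K j y ∂μ ≤ ∫⁻ x, f x ∂π := by
  have hstep : ∀ g : X → ℝ≥0∞, Measurable g →
      ∫⁻ x, g x ∂π = ∫⁻ x, ∫⁻ y, g y ∂K x ∂π + π C * ∫⁻ y, g y ∂μ := by
    intro g hg
    rw [← lintegral_kernelIter_of_invariant hπ hg,
      lintegral_congr (lintegral_add_indicator_const hP g), lintegral_add_left hg.lintegral_kernel,
      lintegral_mul_const _ (measurable_one.indicator hC), lintegral_indicator_one hC]
  have hsum : ∀ J : ℕ, ∫⁻ x, f x ∂π = ∫⁻ x, ∫⁻ y, f y ∂kernelIter K J x ∂π +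
      π C * ∑ j ∈ Finset.range J, ∫⁻ y, ∫⁻ z, f z ∂kernelIter K j y ∂μ := by
    intro J
    induction J with
    | zero => simp [lintegral_kernelIter_zero K hf]
    | succ J ih =>
      rw [ih, hstep _ hf.lintegral_kernel, Finset.sum_range_succ]
      simp only [lintegral_kernelIter_succ K J hf]
      ring
  rw [ENNReal.tsum_eq_iSup_nat, ENNReal.mul_iSup]
  exact iSup_le fun J => by rw [hsum J]; exact le_add_self

theorem mul_tsum_rate_le_lintegral {C : Set X} (hC : MeasurableSet C) {μ π : Measure X}
    (hP : ∀ x, P x = K x + C.indicator (fun _ => μ) x) (hπ : Kernel.Invariant P π)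
    {r : ℕ → ℝ≥0∞} (hr : Monotone r) (hr0 : r 0 = 0) :
    π C * ∑' k, r (k + 1) * ∫⁻ y, kernelIter K k y univ ∂μ ≤
      ∫⁻ x, ∑' m, (r (m + 1) - r m) * kernelIter K m x univ ∂π := by
  have hmeas : ∀ m, Measurable fun x => (r (m + 1) - r m) * kernelIter K m x univ := fun m =>
    (Kernel.measurable_coe _ .univ).const_mul _
  refine le_trans (le_of_eq ?_)
    (mul_tsum_lintegral_kernelIter_le hC hP hπ (Measurable.tsum hmeas))
  congr 1
  have hj : ∀ j, ∫⁻ y, ∫⁻ z, ∑' m, (r (m + 1) - r m) * kernelIter K m z univ ∂kernelIter K j y ∂μ =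
      ∑' m, (r (m + 1) - r m) * ∫⁻ y, kernelIter K (j + m) y univ ∂μ := by
    intro j
    have h1 : ∀ y, ∫⁻ z, ∑' m, (r (m + 1) - r m) * kernelIter K m z univ ∂kernelIter K j y =
        ∑' m, (r (m + 1) - r m) * kernelIter K (j + m) y univ := by
      intro y
      rw [lintegral_tsum fun m => (hmeas m).aemeasurable]
      refine tsum_congr fun m => ?_
      rw [lintegral_const_mul _ (Kernel.measurable_coe _ .univ), kernelIter_add_apply_univ]
    rw [lintegral_congr h1, lintegral_tsum fun m =>
      ((Kernel.measurable_coe _ .univ).const_mul _).aemeasurable]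
    exact tsum_congr fun m => lintegral_const_mul _ (Kernel.measurable_coe _ .univ)
  rw [tsum_congr hj, ENNReal.tsum_tsum_eq_tsum_sum_antidiagonal]
  refine tsum_congr fun k => ?_
  have h2 : ∑ p ∈ Finset.HasAntidiagonal.antidiagonal k,
      (r (p.2 + 1) - r p.2) * ∫⁻ y, kernelIter K (p.1 + p.2) y univ ∂μ =
      ∑ p ∈ Finset.HasAntidiagonal.antidiagonal k,
        (r (p.2 + 1) - r p.2) * ∫⁻ y, kernelIter K k y univ ∂μ :=
    Finset.sum_congr rfl fun p hp => by rw [Finset.HasAntidiagonal.mem_antidiagonal.1 hp]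
  rw [h2, ← Finset.sum_mul, ← Finset.Nat.sum_antidiagonal_swap,
    Finset.Nat.sum_antidiagonal_eq_sum_range_succ_mk]
  congr 1
  simpa [hr0] using (sum_range_tsub_of_monotone hr 0 (k + 1)).symm

end Occupation

section Renewal

theorem tendsto_ratio_add {ρ : ℕ → ℝ} (hone : ∀ k, 1 ≤ ρ k)
    (hratio : Tendsto (fun j => ρ (j + 1) / ρ j) atTop (nhds 1)) (i : ℕ) :
    Tendsto (fun j => ρ (j + i) / ρ j) atTop (nhds 1) := by
  have hne : ∀ k, ρ k ≠ 0 := fun k => (one_pos.trans_le (hone k)).ne'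
  induction i with
  | zero => simp [div_self (hne _)]
  | succ i ih =>
    have h := (hratio.comp (tendsto_add_atTop_nat i)).mul ih
    rw [one_mul] at h
    refine h.congr fun j => ?_
    simp only [Function.comp_apply]
    rw [div_mul_div_cancel₀ (hne _), add_assoc]

/-- A defective renewal sequence with subgeometric weights: the weighted mass of the inter-arrival
distribution, seen from a late time, is still less than one. -/
theorem eventually_tsum_shift_le {ρ : ℕ → ℝ} (hone : ∀ k, 1 ≤ ρ k)
    (hsub : ∀ i j, ρ (i + j) ≤ ρ i * ρ j)
    (hratio : Tendsto (fun j => ρ (j + 1) / ρ j) atTop (nhds 1)) {f : ℕ → ℝ≥0∞}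
    (hf : ∑' i, f i < 1) (hρf : ∑' i, ENNReal.ofReal (ρ i) * f i ≠ ⊤) :
    ∃ θ : ℝ≥0∞, θ < 1 ∧ ∀ᶠ j in atTop,
      ∑' i, ENNReal.ofReal (ρ (j + (i + 1))) * f i ≤ θ * ENNReal.ofReal (ρ j) := by
  have hpos : ∀ k, 0 < ρ k := fun k => one_pos.trans_le (hone k)
  have hftop : ∀ i, f i ≠ ⊤ := fun i => ((ENNReal.le_tsum i).trans_lt (hf.trans one_lt_top)).ne
  have hfof : ∀ i, f i = ENNReal.ofReal (f i).toReal := fun i => (ENNReal.ofReal_toReal (hftop i)).symm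
  have hbound : Summable fun i => (f i).toReal * ρ (i + 1) := by
    have h1 : Summable fun i => (ENNReal.ofReal (ρ i) * f i).toReal := ENNReal.summable_toReal hρf
    refine Summable.of_nonneg_of_le (fun i => mul_nonneg toReal_nonneg (hpos _).le) (fun i => ?_)
      (h1.mul_left (ρ 1))
    rw [toReal_mul, ENNReal.toReal_ofReal (hpos i).le]
    calc (f i).toReal * ρ (i + 1) ≤ (f i).toReal * (ρ i * ρ 1) := by gcongr; exact hsub i 1
      _ = _ := by ring
  have hle : ∀ j i, (f i).toReal * (ρ (j + (i + 1)) / ρ j) ≤ (f i).toReal * ρ (i + 1) := by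
    intro j i
    gcongr
    rw [div_le_iff₀ (hpos j), mul_comm]
    exact hsub j (i + 1)
  have hnn : ∀ j i, 0 ≤ (f i).toReal * (ρ (j + (i + 1)) / ρ j) := fun j i =>
    mul_nonneg toReal_nonneg (div_pos (hpos _) (hpos _)).le
  have hlim : Tendsto (fun j => ∑' i, (f i).toReal * (ρ (j + (i + 1)) / ρ j)) atTop
      (nhds (∑' i, (f i).toReal)) := by
    refine tendsto_tsum_of_dominated_convergence hbound (fun i => ?_)
      (Eventually.of_forall fun j i => ?_)
    · simpa using (tendsto_ratio_add hone hratio (i + 1)).const_mul (f i).toReal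
    · rw [Real.norm_of_nonneg (hnn j i)]
      exact hle j i
  have hlt : ∑' i, (f i).toReal < 1 := by
    rw [← ENNReal.tsum_toReal_eq hftop]
    exact (ENNReal.toReal_lt_toReal (hf.trans one_lt_top).ne one_ne_top).2 hf
  obtain ⟨θ, hθ1, hθ2⟩ := exists_between hlt
  refine ⟨ENNReal.ofReal θ, by simpa using hθ2, ?_⟩
  filter_upwards [hlim.eventually (gt_mem_nhds hθ1)] with j hj
  have hS : ∑' i, ENNReal.ofReal (ρ (j + (i + 1))) * f i =
      ENNReal.ofReal (ρ j * ∑' i, (f i).toReal * (ρ (j + (i + 1)) / ρ j)) := by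
    rw [ENNReal.ofReal_mul (hpos j).le, ENNReal.ofReal_tsum_of_nonneg (hnn j)
      (hbound.of_nonneg_of_le (hnn j) (hle j)), ← ENNReal.tsum_mul_left]
    refine tsum_congr fun i => ?_
    conv_lhs => rw [hfof i]
    rw [← ENNReal.ofReal_mul (hpos _).le, ← ENNReal.ofReal_mul (hpos _).le]
    congr 1
    have := (hpos j).ne'
    field_simp
  rw [hS, mul_comm (ENNReal.ofReal θ), ← ENNReal.ofReal_mul (hpos j).le]
  exact ENNReal.ofReal_le_ofReal (mul_le_mul_of_nonneg_left hj.le (hpos j).le)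

/-- Subgeometric moments of the solution of a defective renewal inequality. -/
theorem tsum_rate_mul_renewal_ne_top {ρ : ℕ → ℝ} (hone : ∀ k, 1 ≤ ρ k)
    (hsub : ∀ i j, ρ (i + j) ≤ ρ i * ρ j)
    (hratio : Tendsto (fun j => ρ (j + 1) / ρ j) atTop (nhds 1)) {f v w : ℕ → ℝ≥0∞}
    (hf : ∑' i, f i < 1) (hρf : ∑' i, ENNReal.ofReal (ρ i) * f i ≠ ⊤)
    (hρw : ∑' i, ENNReal.ofReal (ρ i) * w i ≠ ⊤) {c : ℝ≥0∞} (hc : c ≠ ⊤) (hv : ∀ k, v k ≤ c)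
    (h0 : v 0 ≤ w 0)
    (hsucc : ∀ k, v (k + 1) ≤ w (k + 1) +
      ∑ p ∈ Finset.HasAntidiagonal.antidiagonal k, f p.1 * v p.2) :
    ∑' k, ENNReal.ofReal (ρ k) * v k ≠ ⊤ := by
  obtain ⟨θ, hθ1, hθ⟩ := eventually_tsum_shift_le hone hsub hratio hf hρf
  obtain ⟨J, hJ⟩ := eventually_atTop.1 hθ
  set S : ℕ → ℝ≥0∞ := fun j => ∑' i, ENNReal.ofReal (ρ (j + (i + 1))) * f i with hSdef
  have hpos : ∀ k, 0 < ρ k := fun k => one_pos.trans_le (hone k)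
  have hStop : ∀ j, S j ≠ ⊤ := by
    intro j
    have : S j ≤ ENNReal.ofReal (ρ (j + 1)) * ∑' i, ENNReal.ofReal (ρ i) * f i := by
      rw [← ENNReal.tsum_mul_left]
      refine ENNReal.tsum_le_tsum fun i => ?_
      rw [← mul_assoc, ← ENNReal.ofReal_mul (hpos _).le]
      gcongr
      rw [show j + (i + 1) = j + 1 + i by ring]
      exact hsub _ _
    exact ne_top_of_le_ne_top (ENNReal.mul_ne_top ofReal_ne_top hρf) this
  set E : ℝ≥0∞ := ∑ j ∈ Finset.range J, c * S j with hE
  have hEtop : E ≠ ⊤ := ENNReal.sum_ne_top.2 fun j _ => ENNReal.mul_ne_top hc (hStop j)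
  have hvS : ∀ N, ∑ j ∈ Finset.range N, v j * S j ≤
      θ * ∑ j ∈ Finset.range N, ENNReal.ofReal (ρ j) * v j + E := by
    intro N
    have hterm : ∀ j, v j * S j ≤ θ * (ENNReal.ofReal (ρ j) * v j) +
        (if j ∈ Finset.range J then c * S j else 0) := by
      intro j
      by_cases hj : j < J
      · simp only [Finset.mem_range, hj, if_true]
        exact (mul_le_mul_left (hv j) _).trans le_add_self
      · simp only [Finset.mem_range, hj, if_false, add_zero]
        calc v j * S j ≤ v j * (θ * ENNReal.ofReal (ρ j)) := by
              gcongr; exact hJ j (not_lt.1 hj)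
          _ = _ := by ring
    calc _ ≤ ∑ j ∈ Finset.range N, (θ * (ENNReal.ofReal (ρ j) * v j) +
          (if j ∈ Finset.range J then c * S j else 0)) := Finset.sum_le_sum fun j _ => hterm j
      _ ≤ _ := by
        rw [Finset.sum_add_distrib, Finset.mul_sum]
        gcongr
        refine (ENNReal.sum_le_tsum _).trans (le_of_eq ?_)
        rw [tsum_eq_sum (s := Finset.range J) fun j hj => if_neg hj]
        exact Finset.sum_congr rfl fun j hj => if_pos hj
  have hconv : ∀ N, ∑ k ∈ Finset.range N, ENNReal.ofReal (ρ (k + 1)) *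
      ∑ p ∈ Finset.HasAntidiagonal.antidiagonal k, f p.1 * v p.2 ≤
      ∑ j ∈ Finset.range N, v j * S j := by
    intro N
    set F : ℕ → ℕ → ℝ≥0∞ := fun i j =>
      if j ∈ Finset.range N then v j * (ENNReal.ofReal (ρ (j + (i + 1))) * f i) else 0 with hF
    calc _ ≤ ∑ k ∈ Finset.range N, ∑ p ∈ Finset.HasAntidiagonal.antidiagonal k, F p.1 p.2 := by
          refine Finset.sum_le_sum fun k hk => ?_
          rw [Finset.mul_sum]
          refine Finset.sum_le_sum fun p hp => le_of_eq ?_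
          have hp' := Finset.HasAntidiagonal.mem_antidiagonal.1 hp
          have hk' := Finset.mem_range.1 hk
          simp only [hF]
          rw [if_pos (Finset.mem_range.2 (by lia)), show p.2 + (p.1 + 1) = k + 1 by lia]
          ring
      _ ≤ ∑' k, ∑ p ∈ Finset.HasAntidiagonal.antidiagonal k, F p.1 p.2 := ENNReal.sum_le_tsum _
      _ = ∑' j, ∑' i, F i j := by
          rw [← ENNReal.tsum_tsum_eq_tsum_sum_antidiagonal, ENNReal.tsum_comm]
      _ = _ := by
          rw [tsum_eq_sum (s := Finset.range N)]
          · refine Finset.sum_congr rfl fun j hj => ?_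
            simp only [hF, if_pos hj, ENNReal.tsum_mul_left, hSdef]
          · intro j hj
            simp only [hF, if_neg hj, tsum_zero]
  have hbound : ∀ N, ∑ k ∈ Finset.range N, ENNReal.ofReal (ρ k) * v k ≤
      (∑' i, ENNReal.ofReal (ρ i) * w i + E) / (1 - θ) := by
    intro N
    set T := ∑ k ∈ Finset.range N, ENNReal.ofReal (ρ k) * v k with hT
    have hTtop : T ≠ ⊤ := ENNReal.sum_ne_top.2 fun k _ =>
      ENNReal.mul_ne_top ofReal_ne_top (ne_top_of_le_ne_top hc (hv k))
    have h1 : T ≤ (∑' i, ENNReal.ofReal (ρ i) * w i + E) + T * θ := by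
      calc T ≤ ∑ k ∈ Finset.range (N + 1), ENNReal.ofReal (ρ k) * v k :=
            Finset.sum_le_sum_of_subset (Finset.range_mono (Nat.le_succ N))
        _ = ∑ k ∈ Finset.range N, ENNReal.ofReal (ρ (k + 1)) * v (k + 1) +
              ENNReal.ofReal (ρ 0) * v 0 := Finset.sum_range_succ' _ _
        _ ≤ ∑ k ∈ Finset.range N, (ENNReal.ofReal (ρ (k + 1)) * w (k + 1) +
              ENNReal.ofReal (ρ (k + 1)) *
                ∑ p ∈ Finset.HasAntidiagonal.antidiagonal k, f p.1 * v p.2) +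
              ENNReal.ofReal (ρ 0) * w 0 := by
            gcongr with k _
            rw [← mul_add]
            gcongr
            exact hsucc k
        _ = ∑ k ∈ Finset.range (N + 1), ENNReal.ofReal (ρ k) * w k +
              ∑ k ∈ Finset.range N, ENNReal.ofReal (ρ (k + 1)) *
                ∑ p ∈ Finset.HasAntidiagonal.antidiagonal k, f p.1 * v p.2 := by
            rw [Finset.sum_add_distrib, Finset.sum_range_succ' (fun k => ENNReal.ofReal (ρ k) * w k)]
            ring
        _ ≤ ∑' i, ENNReal.ofReal (ρ i) * w i + (θ * T + E) := by
            gcongr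
            · exact ENNReal.sum_le_tsum _
            · exact (hconv N).trans (hvS N)
        _ = _ := by ring
    have hθ0 : 1 - θ ≠ 0 := (tsub_pos_of_lt hθ1).ne'
    rw [ENNReal.le_div_iff_mul_le (Or.inl hθ0) (Or.inl (ENNReal.sub_ne_top one_ne_top))]
    have hTθ : T * θ ≠ ⊤ := ENNReal.mul_ne_top hTtop (hθ1.trans one_lt_top).ne
    refine (ENNReal.add_le_add_iff_right hTθ).1 ?_
    rwa [← mul_add, tsub_add_cancel_of_le hθ1.le, mul_one]
  refine ne_top_of_le_ne_top (ENNReal.div_ne_top (ENNReal.add_ne_top.2 ⟨hρw, hEtop⟩)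
    (tsub_pos_of_lt hθ1).ne') ?_
  rw [ENNReal.tsum_eq_iSup_nat]
  exact iSup_le hbound

end Renewal

section Rate

theorem log_add_le_of_antitone_div {r₀ : ℕ → ℝ}
    (hdec : ∀ m n : ℕ, 1 ≤ m → m ≤ n → Real.log (r₀ n) / n ≤ Real.log (r₀ m) / m) {m n : ℕ}
    (hm : 1 ≤ m) (hn : 1 ≤ n) : Real.log (r₀ (m + n)) ≤ Real.log (r₀ m) + Real.log (r₀ n) := by
  have hm' : (0 : ℝ) < m := by exact_mod_cast hm
  have hn' : (0 : ℝ) < n := by exact_mod_cast hn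
  have h1 := hdec m (m + n) hm (by lia)
  have h2 := hdec n (m + n) hn (by lia)
  have h3 := mul_le_mul_of_nonneg_left h1 hm'.le
  have h4 := mul_le_mul_of_nonneg_left h2 hn'.le
  rw [mul_div_cancel₀ _ hm'.ne'] at h3
  rw [mul_div_cancel₀ _ hn'.ne'] at h4
  have h5 : (m : ℝ) * (Real.log (r₀ (m + n)) / (m + n : ℕ)) +
      n * (Real.log (r₀ (m + n)) / (m + n : ℕ)) = Real.log (r₀ (m + n)) := by
    push_cast
    field_simp
  linarith

theorem submultiplicative_of_antitone_div {r₀ : ℕ → ℝ} (hone : ∀ k, 1 ≤ r₀ k)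
    (hdec : ∀ m n : ℕ, 1 ≤ m → m ≤ n → Real.log (r₀ n) / n ≤ Real.log (r₀ m) / m) (m n : ℕ) :
    r₀ (m + n) ≤ r₀ m * r₀ n := by
  have hpos : ∀ k, 0 < r₀ k := fun k => one_pos.trans_le (hone k)
  rcases Nat.eq_zero_or_pos m with rfl | hm
  · rw [zero_add]
    exact le_mul_of_one_le_left (hpos n).le (hone 0)
  rcases Nat.eq_zero_or_pos n with rfl | hn
  · exact le_mul_of_one_le_right (hpos m).le (hone 0)
  rw [← Real.log_le_log_iff (hpos _) (mul_pos (hpos _) (hpos _)),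
    Real.log_mul (hpos _).ne' (hpos _).ne']
  exact log_add_le_of_antitone_div hdec hm hn

theorem tendsto_succ_div_of_antitone_div {r₀ : ℕ → ℝ} (hone : ∀ k, 1 ≤ r₀ k) (hmono : Monotone r₀)
    (hdec : ∀ m n : ℕ, 1 ≤ m → m ≤ n → Real.log (r₀ n) / n ≤ Real.log (r₀ m) / m)
    (hlim : Tendsto (fun n => Real.log (r₀ n) / n) atTop (nhds 0)) :
    Tendsto (fun j => r₀ (j + 1) / r₀ j) atTop (nhds 1) := by
  have hpos : ∀ k, 0 < r₀ k := fun k => one_pos.trans_le (hone k)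
  have hexp : Tendsto (fun n : ℕ => Real.exp (Real.log (r₀ n) / n)) atTop (nhds 1) := by
    simpa [Function.comp_def] using (Real.continuous_exp.tendsto 0).comp hlim
  refine tendsto_of_tendsto_of_tendsto_of_le_of_le' tendsto_const_nhds hexp
    (Eventually.of_forall fun j => (one_le_div (hpos j)).2 (hmono (Nat.le_succ j))) ?_
  filter_upwards [eventually_ge_atTop 1] with j hj
  have hj' : (0 : ℝ) < j := by exact_mod_cast hj
  rw [← Real.log_le_iff_le_exp (div_pos (hpos _) (hpos _)),
    Real.log_div (hpos _).ne' (hpos _).ne']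
  have h1 := hdec j (j + 1) hj (Nat.le_succ j)
  rw [div_le_iff₀ (by positivity)] at h1
  push_cast at h1
  have h2 : Real.log (r₀ j) / j * (j + 1) = Real.log (r₀ j) + Real.log (r₀ j) / j := by
    field_simp
  linarith

/-- A subgeometric rate is equivalent to a submultiplicative sequence whose consecutive ratios
tend to one. -/
theorem SubgeometricRate.exists_submultiplicative {r : ℕ → ℝ} (hr : SubgeometricRate r) :
    ∃ ρ : ℕ → ℝ, (∀ k, 1 ≤ ρ k) ∧ Monotone ρ ∧ (∀ i j, ρ (i + j) ≤ ρ i * ρ j) ∧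
      Tendsto (fun j => ρ (j + 1) / ρ j) atTop (nhds 1) ∧
      Tendsto (fun k => r k / ρ k) atTop (nhds 1) := by
  obtain ⟨-, -, ρ, h0, hmono, hdec, hlim, hequiv⟩ := hr
  have hone : ∀ k, 1 ≤ ρ k := fun k => h0.trans (hmono (Nat.zero_le k))
  exact ⟨ρ, hone, hmono, submultiplicative_of_antitone_div hone hdec,
    tendsto_succ_div_of_antitone_div hone hmono hdec hlim, hequiv⟩

theorem exists_le_mul_of_tendsto_div {a b : ℕ → ℝ} (hb : ∀ k, 0 < b k) {l : ℝ}
    (h : Tendsto (fun k => a k / b k) atTop (nhds l)) : ∃ c : ℝ, 0 < c ∧ ∀ k, a k ≤ c * b k := by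
  obtain ⟨c, hc⟩ := h.bddAbove_range
  refine ⟨max c 1, by positivity, fun k => ?_⟩
  rw [← div_le_iff₀ (hb k)]
  exact (hc ⟨k, rfl⟩).trans (le_max_left _ _)

theorem SubgeometricRate.exists_shift_le {r : ℕ → ℝ} (hr : SubgeometricRate r) (i : ℕ) {δ : ℝ}
    (hδ : 0 < δ) : ∃ L : ℝ, 0 ≤ L ∧ ∀ k, r (k + i) ≤ (1 + δ) * r k + L := by
  obtain ⟨ρ, hone, hmono, hsub, hratio, hequiv⟩ := hr.exists_submultiplicative
  have hpos : ∀ k, 0 < ρ k := fun k => one_pos.trans_le (hone k)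
  have h1 : Tendsto (fun k => r (k + i) / ρ k) atTop (nhds 1) := by
    have := (hequiv.comp (tendsto_add_atTop_nat i)).mul (tendsto_ratio_add hone hratio i)
    rw [one_mul] at this
    refine this.congr fun k => ?_
    simp only [Function.comp_apply]
    rw [div_mul_div_cancel₀ (hpos _).ne']
  have h2 : Tendsto (fun k => (1 + δ) * (r k / ρ k)) atTop (nhds (1 + δ)) := by
    simpa using hequiv.const_mul (1 + δ)
  obtain ⟨N, hN⟩ := eventually_atTop.1 (h1.eventually_lt h2 (by linarith))
  refine ⟨r (N + i), hr.1 _, fun k => ?_⟩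
  rcases le_total N k with hk | hk
  · have h3 := hN k hk
    rw [← mul_div_assoc, div_lt_div_iff_of_pos_right (hpos k)] at h3
    linarith [hr.1 (N + i)]
  · have h3 : r (k + i) ≤ r (N + i) := hr.2.1 (by lia)
    have h4 := mul_nonneg (by linarith : 0 ≤ 1 + δ) (hr.1 k)
    linarith

end Rate

section Accessibility

variable {P K : Kernel X X}

/-- A state-dependent drift condition towards `C` makes `C` accessible. -/
theorem accessible_of_drift [IsMarkovKernel P] {C : Set X} (hC : MeasurableSet C) {W : X → ℝ}
    (hW1 : ∀ x, 1 ≤ W x) {n : X → ℕ} {β : ℝ} (hβ : β ∈ Ioo (0 : ℝ) 1)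
    (hdrift : ∀ x ∉ C, ∫⁻ y, ENNReal.ofReal (W y) ∂kernelIter P (n x) x ≤
      ENNReal.ofReal (β * W x)) :
    Accessible P C := by
  intro x
  by_contra! hx
  set Y : Set X := {y | ∀ k, kernelIter P k y C = 0} with hY
  have hae : ∀ y : X, ∀ j : ℕ, (∀ k, kernelIter P (j + k) y C = 0) →
      ∀ᵐ z ∂kernelIter P j y, z ∈ Y := by
    intro y j hy
    simp only [hY, mem_ofPred_eq]
    refine ae_all_iff.2 fun k => ?_
    have h := hy k
    rw [kernelIter_add_apply P j k hC,
      lintegral_eq_zero_iff (Kernel.measurable_coe _ hC)] at h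
    exact h
  obtain ⟨y₀, hy₀⟩ := (hae x 1 fun k => nonpos_iff_eq_zero.1 (hx (1 + k) (by lia))).exists
  have hbdd : BddBelow (W '' Y) := ⟨1, by rintro _ ⟨y, -, rfl⟩; exact hW1 y⟩
  have hne : (W '' Y).Nonempty := ⟨_, y₀, hy₀, rfl⟩
  set m := sInf (W '' Y)
  have hm1 : 1 ≤ m := le_csInf hne (by rintro _ ⟨y, -, rfl⟩; exact hW1 y)
  have hlt : m < m / β := by
    rw [lt_div_iff₀ hβ.1]
    nlinarith [hβ.2]
  obtain ⟨_, ⟨y, hy, rfl⟩, hym⟩ := exists_lt_of_csInf_lt hne hlt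
  have hyC : y ∉ C := by
    have := hy 0
    rw [kernelIter_zero_apply P hC] at this
    intro h
    simp [h] at this
  have hle : ENNReal.ofReal m ≤ ENNReal.ofReal (β * W y) := by
    calc ENNReal.ofReal m = ∫⁻ _, ENNReal.ofReal m ∂kernelIter P (n y) y := by simp
      _ ≤ ∫⁻ z, ENNReal.ofReal (W z) ∂kernelIter P (n y) y := by
        refine lintegral_mono_ae ?_
        filter_upwards [hae y (n y) fun k => hy _] with z hz
        exact ENNReal.ofReal_le_ofReal (csInf_le hbdd ⟨z, hz, rfl⟩)
      _ ≤ _ := hdrift y hyC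
  rw [ENNReal.ofReal_le_ofReal_iff (mul_nonneg hβ.1.le (by linarith [hW1 y]))] at hle
  rw [lt_div_iff₀ hβ.1] at hym
  linarith

theorem Accessible.measure_pos {C : Set X} (hC : MeasurableSet C) (hacc : Accessible P C)
    {π : Measure X} (hπ0 : π ≠ 0) (hπ : Kernel.Invariant P π) : π C ≠ 0 := by
  intro h0
  have hinv : ∀ k, ∫⁻ x, kernelIter P k x C ∂π = 0 := by
    intro k
    induction k with
    | zero => simp [kernelIter_zero_apply P hC, lintegral_indicator_one hC, h0]
    | succ k ih =>
      rw [lintegral_congr fun x => kernelIter_succ_apply P k hC x,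
        lintegral_kernelIter_of_invariant hπ (Kernel.measurable_coe _ hC), ih]
  have hae : ∀ᵐ x ∂π, ∀ k, kernelIter P k x C = 0 := ae_all_iff.2 fun k =>
    (lintegral_eq_zero_iff (Kernel.measurable_coe _ hC)).1 (hinv k)
  have : (ae π).NeBot := ae_neBot.2 hπ0
  obtain ⟨x, hx⟩ := hae.exists
  obtain ⟨k, -, hk⟩ := hacc x
  exact hk.ne' (hx k)

end Accessibility

section Splitting

variable {P K : Kernel X X}

/-- The residual kernel `P - 1_C ⊗ μ` of a minorization on `C`. -/
theorem exists_residual_kernel {C : Set X} (hC : MeasurableSet C) {μ : Measure X}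
    [IsFiniteMeasure μ] (h : ∀ x ∈ C, μ ≤ P x) :
    ∃ K : Kernel X X, ∀ x, P x = K x + C.indicator (fun _ => μ) x := by
  classical
  refine ⟨⟨fun x => P x - C.indicator (fun _ => μ) x, ?_⟩, fun x => ?_⟩
  · refine Measure.measurable_of_measurable_coe _ fun s hs => ?_
    have : (fun x => (P x - C.indicator (fun _ => μ) x) s) =
        fun x => P x s - C.indicator (fun _ => μ s) x := by
      ext x
      by_cases hx : x ∈ C
      · simp [hx, Measure.sub_apply hs (h x hx)]
      · simp [hx]
    rw [this]
    exact (Kernel.measurable_coe P hs).sub (measurable_const.indicator hC)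
  · by_cases hx : x ∈ C
    · simp [hx, Measure.sub_add_cancel_of_le (h x hx)]
    · simp [hx]

theorem le_of_eq_add_indicator {C : Set X} {μ : Measure X}
    (hP : ∀ x, P x = K x + C.indicator (fun _ => μ) x) (x : X) : K x ≤ P x := by
  rw [hP x]
  exact Measure.le_add_right le_rfl

theorem residual_univ_add [IsMarkovKernel P] {C : Set X} {μ : Measure X}
    (hP : ∀ x, P x = K x + C.indicator (fun _ => μ) x) (x : X) :
    K x univ + C.indicator 1 x * μ univ = 1 := by
  have h := lintegral_add_indicator_const hP 1 x
  simpa using h.symm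

/-- If a cycle between regenerations reaches `D` with positive probability, then the probability
to regenerate without visiting `D` is less than one. -/
theorem tsum_regeneration_lt_one [IsMarkovKernel P] {C D : Set X} (hC : MeasurableSet C)
    (hD : MeasurableSet D) {μ : Measure X} [IsFiniteMeasure μ]
    (hP : ∀ x, P x = K x + C.indicator (fun _ => μ) x)
    (hreach : ∃ j, ∫⁻ y, kernelIter K j y D ∂μ ≠ 0) :
    ∑' i, ∫⁻ y, kernelIter (K.restrict hD.compl) i y C ∂μ.restrict Dᶜ < 1 := by
  set B := K.restrict hD.compl with hB
  set m := μ.restrict Dᶜ with hm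
  set f : ℕ → ℝ≥0∞ := fun i => ∫⁻ y, kernelIter B i y C ∂m with hf
  set g : ℕ → ℝ≥0∞ := fun i => ∫⁻ y, ∫⁻ z, K z D ∂kernelIter B i y ∂m with hg
  have hKD : Measurable fun z => K z D := Kernel.measurable_coe K hD
  have hpt : ∀ x, B x univ + (K x D + C.indicator 1 x * μ univ) = 1 := by
    intro x
    rw [← residual_univ_add hP x, hB, Kernel.restrict_apply, Measure.restrict_apply_univ,
      ← measure_add_measure_compl hD (μ := K x)]
    ring
  have hstep : ∀ i y, kernelIter B i y univ = kernelIter B (i + 1) y univ +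
      (∫⁻ z, K z D ∂kernelIter B i y + kernelIter B i y C * μ univ) := by
    intro i y
    rw [kernelIter_add_apply_univ, ← lintegral_indicator_one hC,
      ← lintegral_mul_const _ (measurable_one.indicator hC), ← lintegral_add_left hKD,
      ← lintegral_add_left (Kernel.measurable_coe _ .univ)]
    simp only [kernelIter_one, hpt, lintegral_one]
  have hsum : ∀ J, μ D + (∑ i ∈ Finset.range J, (g i + f i * μ univ) +
      ∫⁻ y, kernelIter B J y univ ∂m) = μ univ := by
    intro J
    induction J with
    | zero =>
      simp [kernelIter_zero_apply, hm, measure_add_measure_compl hD]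
    | succ J ih =>
      have hJ : ∫⁻ y, kernelIter B J y univ ∂m =
          ∫⁻ y, kernelIter B (J + 1) y univ ∂m + (g J + f J * μ univ) := by
        rw [lintegral_congr fun y => hstep J y,
          lintegral_add_left (Kernel.measurable_coe _ .univ),
          lintegral_add_left hKD.lintegral_kernel,
          lintegral_mul_const _ (Kernel.measurable_coe _ hC)]
      refine Eq.trans ?_ ih
      rw [hJ, Finset.sum_range_succ]
      ring
  have htotal : μ D + ∑' i, g i + (∑' i, f i) * μ univ ≤ μ univ := by
    rw [add_assoc, ← ENNReal.tsum_mul_right, ← ENNReal.tsum_add, ENNReal.tsum_eq_iSup_nat,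
      ENNReal.add_iSup]
    refine iSup_le fun J => ?_
    exact le_trans (add_le_add le_rfl le_self_add) (hsum J).le
  have hpos : μ D + ∑' i, g i ≠ 0 := by
    intro h0
    rw [add_eq_zero, ENNReal.tsum_eq_zero] at h0
    obtain ⟨hμD, hg0⟩ := h0
    have hcmp : ∀ i, ∀ φ : X → ℝ≥0∞, Measurable φ → (∀ x, φ x ≤ 1) →
        ∫⁻ y, ∫⁻ z, φ z ∂kernelIter K i y ∂μ ≤ ∫⁻ y, ∫⁻ z, φ z ∂kernelIter B i y ∂m := by
      intro i
      induction i with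
      | zero =>
        intro φ hφ hφ1
        simp only [lintegral_kernelIter_zero _ hφ]
        rw [← lintegral_add_compl φ hD, setLIntegral_measure_zero D φ hμD, zero_add]
      | succ i ih =>
        intro φ hφ hφ1
        simp only [lintegral_kernelIter_add _ i 1 hφ, kernelIter_one]
        have hle1 : ∀ z, ∫⁻ w, φ w ∂K z ≤ 1 := fun z =>
          calc ∫⁻ w, φ w ∂K z ≤ ∫⁻ w, 1 ∂P z :=
                lintegral_mono' (le_of_eq_add_indicator hP z) hφ1
            _ = 1 := by simp
        have hdec : ∀ z, ∫⁻ w, φ w ∂K z ≤ K z D + ∫⁻ w, φ w ∂B z := by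
          intro z
          rw [← lintegral_add_compl φ hD, hB, Kernel.restrict_apply]
          gcongr
          calc ∫⁻ w in D, φ w ∂K z ≤ ∫⁻ _ in D, 1 ∂K z := lintegral_mono hφ1
            _ = K z D := by simp
        calc _ ≤ ∫⁻ y, ∫⁻ z, ∫⁻ w, φ w ∂K z ∂kernelIter B i y ∂m :=
              ih _ hφ.lintegral_kernel hle1
          _ ≤ ∫⁻ y, ∫⁻ z, (K z D + ∫⁻ w, φ w ∂B z) ∂kernelIter B i y ∂m :=
              lintegral_mono fun y => lintegral_mono hdec
          _ = g i + ∫⁻ y, ∫⁻ z, ∫⁻ w, φ w ∂B z ∂kernelIter B i y ∂m := by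
              simp only [lintegral_add_left hKD]
              rw [lintegral_add_left hKD.lintegral_kernel]
          _ = _ := by rw [hg0 i, zero_add]
    obtain ⟨j, hj⟩ := hreach
    refine hj ?_
    cases j with
    | zero => simp [kernelIter_zero_apply _ hD, lintegral_indicator_one hD, hμD]
    | succ j =>
      simp only [kernelIter_add_apply K j 1 hD, kernelIter_one]
      refine nonpos_iff_eq_zero.1 ((hcmp j _ hKD fun z => ?_).trans_eq (hg0 j))
      exact (le_of_eq_add_indicator hP z D).trans prob_le_one
  by_contra! hge
  have hμtop : μ univ ≠ ⊤ := measure_ne_top μ univ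
  have hle : μ D + ∑' i, g i + μ univ ≤ 0 + μ univ := by
    rw [zero_add]
    refine le_trans ?_ htotal
    gcongr
    exact le_mul_of_one_le_left' hge
  exact hpos (nonpos_iff_eq_zero.1 ((ENNReal.add_le_add_iff_right hμtop).1 hle))

/-- Integrability of the cycle length between regenerations at `C` yields an accessible subset of
`C` to which the chain returns with uniformly bounded moments. -/
theorem exists_accessible_subset_of_lifetime [IsMarkovKernel P] {C : Set X} (hC : MeasurableSet C)
    (hacc : Accessible P C) {μ : Measure X} [IsFiniteMeasure μ] (hμ : μ ≠ 0)
    (hP : ∀ x, P x = K x + C.indicator (fun _ => μ) x) {ρ : ℕ → ℝ} (hone : ∀ k, 1 ≤ ρ k)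
    (hsub : ∀ i j, ρ (i + j) ≤ ρ i * ρ j)
    (hratio : Tendsto (fun j => ρ (j + 1) / ρ j) atTop (nhds 1))
    (hlife : ∑' k, ENNReal.ofReal (ρ k) * ∫⁻ y, kernelIter K k y univ ∂μ ≠ ⊤) :
    ∃ D ⊆ C, MeasurableSet D ∧ Accessible P D ∧ ∃ M : ℝ≥0∞, M ≠ ⊤ ∧
      ∀ x ∈ D, ∑' k, ENNReal.ofReal (ρ k) * survival P D k x ≤ M := by
  have hKP := le_of_eq_add_indicator hP
  have hmeas : ∀ (Q : Kernel X X) (k : ℕ), Measurable fun y => kernelIter Q k y univ := fun Q k =>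
    Kernel.measurable_coe _ .univ
  have hpos : ∀ k, 0 < ρ k := fun k => one_pos.trans_le (hone k)
  set H : X → ℝ≥0∞ := fun x => ∑' k, ENNReal.ofReal (ρ k) * kernelIter K k x univ with hH
  have hHmeas : Measurable H := Measurable.tsum fun k => (hmeas K k).const_mul _
  have hHμ : ∫⁻ x, H x ∂μ ≠ ⊤ := by
    rw [lintegral_tsum fun k => ((hmeas K k).const_mul _).aemeasurable]
    simpa only [lintegral_const_mul _ (hmeas K _)] using hlife
  have hHK : ∀ j x, ∫⁻ y, H y ∂kernelIter K j x ≤ H x := by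
    intro j x
    rw [lintegral_tsum fun k => ((hmeas K k).const_mul _).aemeasurable]
    refine ENNReal.tsum_le_tsum fun k => ?_
    rw [lintegral_const_mul _ (hmeas K k), ← kernelIter_add_apply_univ]
    exact mul_le_mul' le_rfl (kernelIter_univ_antitone hKP x (Nat.le_add_left k j))
  -- the chain started from `μ` visits `C` before regenerating
  obtain ⟨j, hj⟩ : ∃ j, ∫⁻ y, kernelIter K j y C ∂μ ≠ 0 := by
    by_contra! h0
    have hconst : ∀ k, ∫⁻ y, kernelIter K k y univ ∂μ = μ univ := by
      intro k
      induction k with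
      | zero => simp [kernelIter_zero_apply]
      | succ k ih =>
        have hsplit : ∀ y, kernelIter K k y univ =
            kernelIter K (k + 1) y univ + kernelIter K k y C * μ univ := by
          intro y
          rw [kernelIter_add_apply_univ, ← lintegral_indicator_one hC,
            ← lintegral_mul_const _ (measurable_one.indicator hC),
            ← lintegral_add_left (hmeas K 1)]
          simp only [kernelIter_one, residual_univ_add hP, lintegral_one]
        rw [← ih, lintegral_congr hsplit, lintegral_add_left (hmeas K _),
          lintegral_mul_const _ (Kernel.measurable_coe _ hC), h0 k, zero_mul, add_zero]
    refine hlife (top_le_iff.1 ?_)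
    calc (⊤ : ℝ≥0∞) = ∑' _ : ℕ, μ univ :=
          (ENNReal.tsum_const_eq_top_of_ne_zero (Measure.measure_univ_ne_zero.2 hμ)).symm
      _ ≤ _ := ENNReal.tsum_le_tsum fun k => by
          rw [hconst k]
          exact le_mul_of_one_le_left' (ENNReal.one_le_ofReal.2 (hone k))
  obtain ⟨N, hN⟩ : ∃ N : ℕ, ∫⁻ y, kernelIter K j y (C ∩ {x | H x ≤ N}) ∂μ ≠ 0 := by
    by_contra! h0
    have hDm : ∀ N : ℕ, MeasurableSet (C ∩ {x | H x ≤ N}) := fun N =>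
      hC.inter (measurableSet_le hHmeas measurable_const)
    set η := μ.bind (kernelIter K j) with hη
    have hηD : ∀ N : ℕ, η (C ∩ {x | H x ≤ N}) = 0 := fun N => by
      rw [hη, Measure.bind_apply (hDm N) (Kernel.aemeasurable _), h0 N]
    have hηH : ∫⁻ x, H x ∂η ≠ ⊤ := by
      rw [hη, Measure.lintegral_bind (Kernel.aemeasurable _) hHmeas.aemeasurable]
      exact ne_top_of_le_ne_top hHμ (lintegral_mono fun x => hHK j x)
    have hηC : η C = 0 := by
      have hfin := ae_lt_top hHmeas hηH
      have hnot : ∀ᵐ x ∂η, ∀ N : ℕ, x ∉ C ∩ {x | H x ≤ N} :=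
        ae_all_iff.2 fun N => measure_eq_zero_iff_ae_notMem.1 (hηD N)
      refine measure_eq_zero_iff_ae_notMem.2 ?_
      filter_upwards [hfin, hnot] with x hx hxN hxC
      obtain ⟨N, hN⟩ := ENNReal.exists_nat_gt hx.ne
      exact hxN N ⟨hxC, hN.le⟩
    rw [hη, Measure.bind_apply hC (Kernel.aemeasurable _)] at hηC
    exact hj hηC
  set D : Set X := C ∩ {x | H x ≤ N} with hDdef
  have hD : MeasurableSet D := hC.inter (measurableSet_le hHmeas measurable_const)
  set A := P.restrict hD.compl with hA
  set B := K.restrict hD.compl with hB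
  set m := μ.restrict Dᶜ with hm
  have hAB : ∀ x, A x = B x + C.indicator (fun _ => m) x := by
    intro x
    rw [hA, hB, Kernel.restrict_apply, Kernel.restrict_apply, hP x, Measure.restrict_add]
    by_cases hx : x ∈ C <;> simp [hx, hm]
  have hBK : ∀ x, B x ≤ K x := fun x => Measure.restrict_le_self
  have hAP : ∀ x, A x ≤ P x := fun x => Measure.restrict_le_self
  have hmμ : m ≤ μ := Measure.restrict_le_self
  set v : ℕ → ℝ≥0∞ := fun k => ∫⁻ y, kernelIter A k y univ ∂m with hv
  have hBle : ∀ (s : Set X) k x, kernelIter B k x s ≤ kernelIter K k x univ := fun s k x =>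
    (kernelIter_mono hBK k x s).trans (measure_mono (subset_univ s))
  have hvfin : ∑' k, ENNReal.ofReal (ρ k) * v k ≠ ⊤ := by
    have hle : ∀ s : Set X, ∑' i, ENNReal.ofReal (ρ i) * ∫⁻ y, kernelIter B i y s ∂m ≠ ⊤ := by
      intro s
      refine ne_top_of_le_ne_top hlife (ENNReal.tsum_le_tsum fun i => ?_)
      exact mul_le_mul' le_rfl (lintegral_mono' hmμ fun y => hBle s i y)
    refine tsum_rate_mul_renewal_ne_top hone hsub hratio
      (tsum_regeneration_lt_one hC hD hP ⟨j, hN⟩) (hle C) (hle univ)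
      (measure_ne_top μ univ) (fun k => ?_) ?_ fun k => ?_
    · calc v k ≤ ∫⁻ _, 1 ∂μ := lintegral_mono' hmμ fun y => kernelIter_univ_le_one hAP k y
        _ = μ univ := by simp
    · simp [hv, kernelIter_zero_apply]
    · refine le_of_eq ?_
      simp only [hv]
      rw [lintegral_congr fun y => kernelIter_univ_renewal hC hAB k y,
        lintegral_add_left (hmeas B _), lintegral_finsetSum]
      · congr 1
        exact Finset.sum_congr rfl fun p _ =>
          lintegral_mul_const _ (Kernel.measurable_coe _ hC)
      · exact fun p _ => (Kernel.measurable_coe _ hC).mul_const _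
  refine ⟨D, inter_subset_left, hD, fun x => ?_, N + ENNReal.ofReal (ρ 1) * N *
    ∑' k, ENNReal.ofReal (ρ k) * v k, ?_, fun x hx => ?_⟩
  · obtain ⟨k, hk1, hk⟩ := hacc x
    refine ⟨k + (1 + j), by lia, ?_⟩
    have hreach : 0 < ∫⁻ y, kernelIter P j y D ∂μ :=
      (pos_iff_ne_zero.2 hN).trans_le (lintegral_mono fun y => kernelIter_mono hKP j y D)
    calc 0 < kernelIter P k x C * ∫⁻ y, kernelIter P j y D ∂μ := ENNReal.mul_pos hk.ne' hreach.ne'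
      _ = ∫⁻ y, C.indicator 1 y * ∫⁻ z, kernelIter P j z D ∂μ ∂kernelIter P k x := by
          rw [lintegral_mul_const _ (measurable_one.indicator hC), lintegral_indicator_one hC]
      _ ≤ ∫⁻ y, kernelIter P (1 + j) y D ∂kernelIter P k x := by
          refine lintegral_mono fun y => ?_
          rw [kernelIter_add_apply P 1 j hD, kernelIter_one, lintegral_add_indicator_const hP]
          exact le_add_self
      _ = _ := (kernelIter_add_apply P k (1 + j) hD x).symm
  · exact ENNReal.add_ne_top.2 ⟨natCast_ne_top N,
      ENNReal.mul_ne_top (ENNReal.mul_ne_top ofReal_ne_top (natCast_ne_top N)) hvfin⟩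
  · have hHx : H x ≤ N := hx.2
    simp only [survival_eq_kernelIter P hD]
    calc ∑' k, ENNReal.ofReal (ρ k) * kernelIter A k x univ
        = ENNReal.ofReal (ρ 0) * kernelIter A 0 x univ +
            ∑' k, ENNReal.ofReal (ρ (k + 1)) * kernelIter A (k + 1) x univ :=
          tsum_eq_zero_add' ENNReal.summable
      _ = (ENNReal.ofReal (ρ 0) * kernelIter B 0 x univ +
            ∑' k, ENNReal.ofReal (ρ (k + 1)) * kernelIter B (k + 1) x univ) +
          ∑' k, ∑ p ∈ Finset.HasAntidiagonal.antidiagonal k,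
            ENNReal.ofReal (ρ (p.1 + p.2 + 1)) * (kernelIter B p.1 x C * v p.2) := by
          rw [add_assoc, ← ENNReal.tsum_add]
          congr 1
          refine tsum_congr fun k => ?_
          rw [kernelIter_univ_renewal hC hAB, mul_add, Finset.mul_sum]
          congr 1
          refine Finset.sum_congr rfl fun p hp => ?_
          rw [Finset.HasAntidiagonal.mem_antidiagonal.1 hp]
      _ = ∑' k, ENNReal.ofReal (ρ k) * kernelIter B k x univ +
          ∑' i, ∑' k, ENNReal.ofReal (ρ (i + k + 1)) * (kernelIter B i x C * v k) := by
          rw [← ENNReal.tsum_tsum_eq_tsum_sum_antidiagonal fun i k =>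
            ENNReal.ofReal (ρ (i + k + 1)) * (kernelIter B i x C * v k)]
          congr 1
          exact (tsum_eq_zero_add'
            (f := fun k => ENNReal.ofReal (ρ k) * kernelIter B k x univ) ENNReal.summable).symm
      _ ≤ H x + ∑' i, ∑' k, ENNReal.ofReal (ρ 1) * (ENNReal.ofReal (ρ i) * kernelIter K i x univ) *
            (ENNReal.ofReal (ρ k) * v k) := by
          refine add_le_add (ENNReal.tsum_le_tsum fun k => mul_le_mul' le_rfl (hBle _ k x))
            (ENNReal.tsum_le_tsum fun i => ENNReal.tsum_le_tsum fun k => ?_)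
          have hρ : ENNReal.ofReal (ρ (i + k + 1)) ≤
              ENNReal.ofReal (ρ i) * ENNReal.ofReal (ρ k) * ENNReal.ofReal (ρ 1) := by
            rw [← ENNReal.ofReal_mul (hpos _).le,
              ← ENNReal.ofReal_mul (mul_pos (hpos _) (hpos _)).le]
            exact ENNReal.ofReal_le_ofReal ((hsub _ _).trans
              (mul_le_mul_of_nonneg_right (hsub i k) (hpos 1).le))
          calc _ ≤ ENNReal.ofReal (ρ i) * ENNReal.ofReal (ρ k) * ENNReal.ofReal (ρ 1) *
                (kernelIter K i x univ * v k) := mul_le_mul' hρ (mul_le_mul' (hBle _ i x) le_rfl)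
            _ = _ := by ring
      _ = H x + ENNReal.ofReal (ρ 1) * H x * ∑' k, ENNReal.ofReal (ρ k) * v k := by
          simp only [ENNReal.tsum_mul_left, ENNReal.tsum_mul_right, hH]
      _ ≤ _ := by gcongr

end Splitting

section DriftFunctions

theorem ConcaveOn.add_le_add_shift {f : ℝ → ℝ} (hf : ConcaveOn ℝ (Ioi 0) f) {a b s : ℝ}
    (ha : 0 < a) (hab : a ≤ b) (hs : 0 ≤ s) : f (b + s) + f a ≤ f (a + s) + f b := by
  rcases hs.eq_or_lt with rfl | hs
  · simp [add_comm]
  have hd : 0 < b - a + s := by linarith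
  have ha' : a ∈ Ioi (0 : ℝ) := ha
  have hbs : b + s ∈ Ioi (0 : ℝ) := by simp only [mem_Ioi]; linarith
  have hw : (b - a) / (b - a + s) + s / (b - a + s) = 1 := by field_simp
  have hw₁ : 0 ≤ (b - a) / (b - a + s) := div_nonneg (by linarith) hd.le
  have hw₂ : 0 ≤ s / (b - a + s) := div_nonneg hs.le hd.le
  have h₁ := hf.2 ha' hbs hw₁ hw₂ hw
  have h₂ := hf.2 ha' hbs hw₂ hw₁ (by rw [add_comm, hw])
  simp only [smul_eq_mul] at h₁ h₂
  have e₁ : (b - a) / (b - a + s) * a + s / (b - a + s) * (b + s) = a + s := by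
    field_simp; ring
  have e₂ : s / (b - a + s) * a + (b - a) / (b - a + s) * (b + s) = b := by
    field_simp; ring
  rw [e₁] at h₁
  rw [e₂] at h₂
  have e₃ : f (b + s) + f a = ((b - a) / (b - a + s) + s / (b - a + s)) * (f (b + s) + f a) := by
    rw [hw, one_mul]
  linarith

/-- If `R` has a log-concave derivative, then `R u ↦ R (u + s)` lies below its tangents. -/
theorem shift_le_tangent {R R' : ℝ → ℝ} (hR : ∀ t ∈ Ioi (0 : ℝ), HasDerivAt R (R' t) t)
    (hR' : ∀ t ∈ Ioi (0 : ℝ), 0 < R' t) (hlog : ConcaveOn ℝ (Ioi 0) fun t => Real.log (R' t))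
    {u v s : ℝ} (hu : 0 < u) (hv : 0 < v) (hs : 0 ≤ s) :
    R (u + s) + R' (v + s) / R' v * R v ≤ R (v + s) + R' (v + s) / R' v * R u := by
  set c := R' (v + s) / R' v with hc
  have hratio : ∀ a b : ℝ, 0 < a → a ≤ b → R' (b + s) * R' a ≤ R' (a + s) * R' b := by
    intro a b ha hab
    have hb : 0 < b := ha.trans_le hab
    have h := hlog.add_le_add_shift ha hab hs
    have p₁ := hR' a ha
    have p₂ := hR' b hb
    have p₃ := hR' (a + s) (add_pos_of_pos_of_nonneg ha hs)
    have p₄ := hR' (b + s) (add_pos_of_pos_of_nonneg hb hs)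
    rw [← Real.log_mul p₄.ne' p₁.ne', ← Real.log_mul p₃.ne' p₂.ne'] at h
    exact (Real.log_le_log_iff (by positivity) (by positivity)).1 h
  have hd : ∀ t : ℝ, 0 < t →
      HasDerivAt (fun t => c * R t - R (t + s)) (c * R' t - R' (t + s)) t := fun t ht =>
    ((hR t ht).const_mul c).sub
      ((hR (t + s) (add_pos_of_pos_of_nonneg ht hs)).comp_add_const t s)
  have hv' := hR' v hv
  rcases le_total v u with h | h
  · have hmono : MonotoneOn (fun t => c * R t - R (t + s)) (Icc v u) := by
      refine monotoneOn_of_deriv_nonneg (convex_Icc v u)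
        (fun t ht => (hd t (hv.trans_le ht.1)).continuousAt.continuousWithinAt)
        (fun t ht => ?_) fun t ht => ?_
      all_goals rw [interior_Icc] at ht
      · exact (hd t (hv.trans ht.1)).differentiableAt.differentiableWithinAt
      · rw [(hd t (hv.trans ht.1)).deriv, sub_nonneg, hc, div_mul_eq_mul_div, le_div_iff₀ hv']
        exact hratio v t hv ht.1.le
    have := hmono (left_mem_Icc.2 h) (right_mem_Icc.2 h) h
    simp only at this
    linarith
  · have hanti : AntitoneOn (fun t => c * R t - R (t + s)) (Icc u v) := by
      refine antitoneOn_of_deriv_nonpos (convex_Icc u v)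
        (fun t ht => (hd t (hu.trans_le ht.1)).continuousAt.continuousWithinAt)
        (fun t ht => ?_) fun t ht => ?_
      all_goals rw [interior_Icc] at ht
      · exact (hd t (hu.trans ht.1)).differentiableAt.differentiableWithinAt
      · rw [(hd t (hu.trans ht.1)).deriv, sub_nonpos, hc, div_mul_eq_mul_div, div_le_iff₀ hv']
        exact hratio t v (hu.trans ht.1) ht.2.le
    have := hanti (left_mem_Icc.2 h) (right_mem_Icc.2 h) h
    simp only at this
    linarith

theorem lintegral_ofReal_le_of_tangent {κ : Measure X} [IsProbabilityMeasure κ] {W g : X → ℝ}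
    (hW : Measurable W) (hg : ∀ z, 0 ≤ g z) {w a c : ℝ} (hw : 0 ≤ w)
    (hc : 0 ≤ c) (h : ∀ z, g z + c * w ≤ a + c * W z)
    (hmean : ∫⁻ z, ENNReal.ofReal (W z) ∂κ ≤ ENNReal.ofReal w) :
    ∫⁻ z, ENNReal.ofReal (g z) ∂κ ≤ ENNReal.ofReal a := by
  refine (ENNReal.add_le_add_iff_right (a := ENNReal.ofReal (c * w)) ofReal_ne_top).1 ?_
  calc ∫⁻ z, ENNReal.ofReal (g z) ∂κ + ENNReal.ofReal (c * w)
      = ∫⁻ z, (ENNReal.ofReal (g z) + ENNReal.ofReal (c * w)) ∂κ := by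
        rw [lintegral_add_right _ measurable_const]; simp
    _ ≤ ∫⁻ z, (ENNReal.ofReal a + ENNReal.ofReal c * ENNReal.ofReal (W z)) ∂κ := by
        refine lintegral_mono fun z => ?_
        rw [← ENNReal.ofReal_add (hg z) (mul_nonneg hc hw), ← ENNReal.ofReal_mul hc]
        exact (ENNReal.ofReal_le_ofReal (h z)).trans ENNReal.ofReal_add_le
    _ = ENNReal.ofReal a + ENNReal.ofReal c * ∫⁻ z, ENNReal.ofReal (W z) ∂κ := by
        rw [lintegral_add_left measurable_const, lintegral_const_mul _ hW.ennreal_ofReal]; simp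
    _ ≤ ENNReal.ofReal a + ENNReal.ofReal (c * w) := by
        rw [ENNReal.ofReal_mul hc]; gcongr

/-- The sequence `R`, reset to `0` at `0`. -/
noncomputable def positiveRate (R : ℝ → ℝ) (k : ℕ) : ℝ≥0∞ :=
  if k = 0 then 0 else ENNReal.ofReal (R k)

theorem positiveRate_le (R : ℝ → ℝ) (k : ℕ) : positiveRate R k ≤ ENNReal.ofReal (R k) := by
  unfold positiveRate
  split_ifs <;> simp

theorem positiveRate_monotone {R : ℝ → ℝ} (hR : Monotone fun k : ℕ => R k) :
    Monotone (positiveRate R) := by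
  intro i j hij
  unfold positiveRate
  split_ifs with hi hj hj
  · exact le_rfl
  · exact zero_le
  · lia
  · exact ENNReal.ofReal_le_ofReal (hR hij)

variable {P : Kernel X X} {W : X → ℝ} {n : X → ℕ} {β b : ℝ} {C : Set X} {R : ℝ → ℝ}

/-- Lyapunov functions `G s` for the rate `R` when `R t / t` is non-increasing. -/
theorem exists_drift_of_antitone_div [IsMarkovKernel P] (hW1 : ∀ x, 1 ≤ W x)
    (hn1 : ∀ x, 1 ≤ n x) (hβ : β ∈ Ioo (0 : ℝ) 1) (hWC : ∃ M : ℝ, ∀ x ∈ C, W x ≤ M)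
    (hdrift : ∀ x, ∫⁻ y, ENNReal.ofReal (W y) ∂kernelIter P (n x) x ≤
      ENNReal.ofReal (β * W x + b * C.indicator (fun _ => 1) x))
    (hWmeas : Measurable W) (hRpos : ∀ t : ℝ, 0 < t → 0 < R t)
    (hRdiv : ∀ s t : ℝ, 0 < s → s ≤ t → R t / t ≤ R s / s) (hRn : ∀ x, R (n x) ≤ W x)
    (e : ℝ≥0∞) :
    ∃ (G : ℕ → X → ℝ≥0∞) (L : ℝ≥0∞), L ≠ ⊤ ∧ (∀ s x, positiveRate R s ≤ G s x) ∧
      (∀ s, ∀ x ∉ C, ∫⁻ y, G (s + n x) y ∂kernelIter P (n x) x ≤ G s x) ∧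
      (∀ s, ∀ x ∈ C, 2 * ∫⁻ y, G (s + n x) y ∂kernelIter P (n x) x ≤
        (2 + e) * positiveRate R s + L) ∧
      ∀ x, G 0 x ≤ ENNReal.ofReal (1 / (1 - β)) * ENNReal.ofReal (W x) := by
  obtain ⟨M, hM⟩ := hWC
  have hβ' : 0 < 1 - β := by linarith [hβ.2]
  set a := ENNReal.ofReal (1 / (1 - β)) with ha
  have hsubadd : ∀ s t : ℝ, 0 < s → 0 < t → R (s + t) ≤ R s + R t := by
    intro s t hs ht
    have h₁ := hRdiv s (s + t) hs (by linarith)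
    have h₂ := hRdiv t (s + t) ht (by linarith)
    have h₃ : R (s + t) / (s + t) * s ≤ R s := by
      calc _ ≤ R s / s * s := by gcongr
        _ = R s := by field_simp
    have h₄ : R (s + t) / (s + t) * t ≤ R t := by
      calc _ ≤ R t / t * t := by gcongr
        _ = R t := by field_simp
    have h₅ : R (s + t) = R (s + t) / (s + t) * s + R (s + t) / (s + t) * t := by
      field_simp
    linarith
  have hrate : ∀ s x, positiveRate R (s + n x) ≤ positiveRate R s + ENNReal.ofReal (W x) := by
    intro s x
    have hn0 : 0 < n x := hn1 x
    have hnpos : (0 : ℝ) < n x := by exact_mod_cast hn0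
    rcases Nat.eq_zero_or_pos s with rfl | hs
    · rw [zero_add]
      exact ((positiveRate_le R _).trans (ENNReal.ofReal_le_ofReal (hRn x))).trans le_add_self
    · have hspos : (0 : ℝ) < s := by exact_mod_cast hs
      rw [positiveRate, positiveRate, if_neg (by lia), if_neg (by lia),
        ← ENNReal.ofReal_add (hRpos _ hspos).le (by linarith [hW1 x])]
      refine ENNReal.ofReal_le_ofReal ?_
      push_cast
      linarith [hsubadd _ _ hspos hnpos, hRn x]
  have hint : ∀ s x, ∫⁻ y, (positiveRate R (s + n x) + a * ENNReal.ofReal (W y))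
      ∂kernelIter P (n x) x ≤ positiveRate R s + (ENNReal.ofReal (W x) +
        a * ENNReal.ofReal (β * W x + b * C.indicator (fun _ => 1) x)) := by
    intro s x
    rw [lintegral_add_left measurable_const, lintegral_const_mul _ hWmeas.ennreal_ofReal,
      lintegral_const, measure_univ, mul_one, ← add_assoc]
    exact add_le_add (hrate s x) (mul_le_mul' le_rfl (hdrift x))
  refine ⟨fun s x => positiveRate R s + a * ENNReal.ofReal (W x),
    2 * (ENNReal.ofReal M + a * ENNReal.ofReal (β * M + b)), ?_, fun s x => le_self_add,
    fun s x hx => ?_, fun s x hx => ?_, fun x => ?_⟩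
  · exact ENNReal.mul_ne_top ofNat_ne_top (ENNReal.add_ne_top.2
      ⟨ofReal_ne_top, ENNReal.mul_ne_top ofReal_ne_top ofReal_ne_top⟩)
  · refine (hint s x).trans (add_le_add le_rfl (le_of_eq ?_))
    have hWx : 0 ≤ W x := by linarith [hW1 x]
    have hβW : 0 ≤ β * W x := mul_nonneg hβ.1.le hWx
    rw [indicator_of_notMem hx, mul_zero, add_zero, ha, ← ENNReal.ofReal_mul (by positivity),
      ← ENNReal.ofReal_mul (by positivity), ← ENNReal.ofReal_add hWx (by positivity)]
    congr 1
    field_simp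
    ring
  · calc _ ≤ 2 * (positiveRate R s + (ENNReal.ofReal M + a * ENNReal.ofReal (β * M + b))) := by
          refine mul_le_mul' le_rfl ((hint s x).trans ?_)
          rw [indicator_of_mem hx, mul_one]
          have := hM x hx
          have := hβ.1
          gcongr
      _ ≤ _ := by
          rw [mul_add]
          gcongr
          exact le_self_add
  · simp [positiveRate]

/-- Lyapunov functions `G s x = R (R⁻¹ (W x) + s)` for a rate `R` with log-concave derivative. -/
theorem exists_drift_of_logConcave_deriv [IsMarkovKernel P] (hW1 : ∀ x, 1 ≤ W x)
    (hβ : β ∈ Ioo (0 : ℝ) 1) (hb : 0 ≤ b) (hWC : ∃ M : ℝ, ∀ x ∈ C, W x ≤ M)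
    (hdrift : ∀ x, ∫⁻ y, ENNReal.ofReal (W y) ∂kernelIter P (n x) x ≤
      ENNReal.ofReal (β * W x + b * C.indicator (fun _ => 1) x))
    (hWmeas : Measurable W) (hRmono : StrictMonoOn R (Ioi 0)) (hRpos : ∀ t : ℝ, 0 < t → 0 < R t)
    (hRrate : SubgeometricRate fun k : ℕ => R k) (hbij : BijOn R (Ioi 0) (Ioi 0)) {R' : ℝ → ℝ}
    (hR' : ∀ t ∈ Ioi (0 : ℝ), HasDerivAt R (R' t) t) (hR'pos : ∀ t ∈ Ioi (0 : ℝ), 0 < R' t)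
    (hlog : ConcaveOn ℝ (Ioi 0) fun t => Real.log (R' t)) {Rinv : ℝ → ℝ}
    (hinv : ∀ t ∈ Ioi (0 : ℝ), Rinv (R t) = t ∧ R (Rinv t) = t)
    (hRn : ∀ x, (n x : ℝ) ≤ Rinv (W x) - Rinv (β * W x)) {e : ℝ≥0∞} (he0 : e ≠ 0)
    (hetop : e ≠ ⊤) :
    ∃ (G : ℕ → X → ℝ≥0∞) (L : ℝ≥0∞), L ≠ ⊤ ∧ (∀ s x, positiveRate R s ≤ G s x) ∧
      (∀ s, ∀ x ∉ C, ∫⁻ y, G (s + n x) y ∂kernelIter P (n x) x ≤ G s x) ∧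
      (∀ s, ∀ x ∈ C, 2 * ∫⁻ y, G (s + n x) y ∂kernelIter P (n x) x ≤
        (2 + e) * positiveRate R s + L) ∧
      ∀ x, G 0 x ≤ ENNReal.ofReal (W x) := by
  obtain ⟨M₀, hM₀⟩ := hWC
  set M := max M₀ 1
  have hM1 : 1 ≤ M := le_max_right _ _
  have hM : ∀ x ∈ C, W x ≤ M := fun x hx => (hM₀ x hx).trans (le_max_left _ _)
  have hWpos : ∀ x, 0 < W x := fun x => one_pos.trans_le (hW1 x)
  have hinvpos : ∀ t : ℝ, 0 < t → 0 < Rinv t := by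
    intro t ht
    obtain ⟨u, hu, rfl⟩ := hbij.surjOn ht
    rw [(hinv u hu).1]
    exact hu
  have hinvmono : ∀ s t : ℝ, 0 < s → s ≤ t → Rinv s ≤ Rinv t := by
    intro s t hs hst
    have ht : 0 < t := hs.trans_le hst
    by_contra! hlt
    have := hRmono (hinvpos t ht) (hinvpos s hs) hlt
    rw [(hinv t ht).2, (hinv s hs).2] at this
    linarith
  have hRle : ∀ s t : ℝ, 0 < s → s ≤ t → R s ≤ R t := fun s t hs hst =>
    hRmono.monotoneOn hs (hs.trans_le hst) hst
  have hjensen : ∀ (s : ℕ) x w, 0 < w →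
      ∫⁻ y, ENNReal.ofReal (W y) ∂kernelIter P (n x) x ≤ ENNReal.ofReal w →
      ∫⁻ y, ENNReal.ofReal (R (Rinv (W y) + ((s + n x : ℕ) : ℝ))) ∂kernelIter P (n x) x ≤
        ENNReal.ofReal (R (Rinv w + ((s + n x : ℕ) : ℝ))) := by
    intro s x w hw hmean
    set k : ℝ := ((s + n x : ℕ) : ℝ)
    have hk : 0 ≤ k := Nat.cast_nonneg _
    have hadd : ∀ t : ℝ, 0 < t → 0 < Rinv t + k := fun t ht =>
      add_pos_of_pos_of_nonneg (hinvpos t ht) hk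
    refine lintegral_ofReal_le_of_tangent hWmeas (c := R' (Rinv w + k) / R' (Rinv w))
      (fun z => (hRpos _ (hadd _ (hWpos z))).le) hw.le
      (div_pos (hR'pos _ (hadd w hw)) (hR'pos _ (hinvpos w hw))).le (fun z => ?_) hmean
    have := shift_le_tangent hR' hR'pos hlog (hinvpos (W z) (hWpos z)) (hinvpos w hw) hk
    rwa [(hinv w hw).2, (hinv _ (hWpos z)).2] at this
  have hβM : 0 < β * M := mul_pos hβ.1 (by linarith)
  set i := ⌈Rinv (β * M + b) + Rinv M⌉₊ with hi
  obtain ⟨L, hL0, hL⟩ := hRrate.exists_shift_le i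
    (half_pos (ENNReal.toReal_pos he0 hetop))
  have hR0 : 0 ≤ R 0 := by simpa using hRrate.1 0
  refine ⟨fun s x => ENNReal.ofReal (R (Rinv (W x) + s)),
    (2 + e) * ENNReal.ofReal (R 0) + 2 * ENNReal.ofReal L, ?_, fun s x => ?_,
    fun s x hx => ?_, fun s x hx => ?_, fun x => ?_⟩
  · exact ENNReal.add_ne_top.2 ⟨ENNReal.mul_ne_top (ENNReal.add_ne_top.2 ⟨ofNat_ne_top, hetop⟩)
      ofReal_ne_top, ENNReal.mul_ne_top ofNat_ne_top ofReal_ne_top⟩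
  · rcases Nat.eq_zero_or_pos s with rfl | hs
    · simp [positiveRate]
    · refine (positiveRate_le R s).trans (ENNReal.ofReal_le_ofReal (hRle _ _ ?_ ?_))
      · exact_mod_cast hs
      · linarith [hinvpos _ (hWpos x)]
  · have hβW : 0 < β * W x := mul_pos hβ.1 (hWpos x)
    refine (hjensen s x (β * W x) hβW ?_).trans (ENNReal.ofReal_le_ofReal (hRle _ _ ?_ ?_))
    · simpa [hx] using hdrift x
    · exact add_pos_of_pos_of_nonneg (hinvpos _ hβW) (Nat.cast_nonneg _)
    · push_cast
      linarith [hRn x]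
  · have hwpos : 0 < β * M + b := by linarith
    have hmean : ∫⁻ y, ENNReal.ofReal (W y) ∂kernelIter P (n x) x ≤
        ENNReal.ofReal (β * M + b) := by
      refine (hdrift x).trans (ENNReal.ofReal_le_ofReal ?_)
      rw [indicator_of_mem hx, mul_one]
      have := mul_le_mul_of_nonneg_left (hM x hx) hβ.1.le
      linarith
    have hnle : Rinv (β * M + b) + ((s + n x : ℕ) : ℝ) ≤ ((s + i : ℕ) : ℝ) := by
      have h₁ := hinvpos (β * W x) (mul_pos hβ.1 (hWpos x))
      have h₂ := hinvmono (W x) M (hWpos x) (hM x hx)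
      have h₃ := Nat.le_ceil (Rinv (β * M + b) + Rinv M)
      push_cast
      linarith [hRn x]
    have hbound : ∫⁻ y, ENNReal.ofReal (R (Rinv (W y) + ((s + n x : ℕ) : ℝ)))
        ∂kernelIter P (n x) x ≤ ENNReal.ofReal ((1 + e.toReal / 2) * R s + L) := by
      refine (hjensen s x _ hwpos hmean).trans (ENNReal.ofReal_le_ofReal ?_)
      exact (hRle _ _ (add_pos_of_pos_of_nonneg (hinvpos _ hwpos) (Nat.cast_nonneg _)) hnle).trans
        (hL s)
    have hRs : ENNReal.ofReal (R s) ≤ positiveRate R s + ENNReal.ofReal (R 0) := by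
      unfold positiveRate
      split_ifs with h
      · simp [h]
      · exact le_self_add
    have htwo : 2 * ENNReal.ofReal (1 + e.toReal / 2) = 2 + e := by
      rw [← ENNReal.ofReal_ofNat 2, ← ENNReal.ofReal_mul zero_le_two, mul_add, mul_one,
        mul_div_cancel₀ _ two_ne_zero, ENNReal.ofReal_add zero_le_two toReal_nonneg,
        ENNReal.ofReal_toReal hetop]
    calc _ ≤ 2 * ENNReal.ofReal ((1 + e.toReal / 2) * R s + L) := mul_le_mul' le_rfl hbound
      _ ≤ 2 * (ENNReal.ofReal (1 + e.toReal / 2) * ENNReal.ofReal (R s) + ENNReal.ofReal L) := by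
          rw [← ENNReal.ofReal_mul (by positivity)]
          exact mul_le_mul' le_rfl ENNReal.ofReal_add_le
      _ = (2 + e) * ENNReal.ofReal (R s) + 2 * ENNReal.ofReal L := by
          rw [mul_add, ← mul_assoc, htwo]
      _ ≤ (2 + e) * (positiveRate R s + ENNReal.ofReal (R 0)) + 2 * ENNReal.ofReal L := by gcongr
      _ = _ := by ring
  · simp [(hinv _ (hWpos x)).2]

end DriftFunctions

/-- Corollary `Pi-integ`(ii).  Under the assumptions of Statement 10, if
moreover `P` admits a unique invariant probability measure `π` with `π(W) < ∞`, then there is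
an accessible small set `D` with `sup_{x ∈ D} 𝔼ₓ[∑_{k=0}^{τ_D - 1} R(k)] < ∞`.
(Here `𝔼ₓ[∑_{k=0}^{τ_D - 1} R(k)] = ∑_{k≥0} R(k) ℙₓ(τ_D > k)`.) -/
theorem statement11
    (P : Kernel X X) [IsMarkovKernel P]
    (hirr : KIrreducible P) (hap : KAperiodic P)
    (W : X → ℝ) (hWmeas : Measurable W) (hW1 : ∀ x, 1 ≤ W x)
    (n : X → ℕ) (hnmeas : Measurable n) (hn1 : ∀ x, 1 ≤ n x)
    (β : ℝ) (hβ : β ∈ Set.Ioo (0 : ℝ) 1) (b : ℝ) (hb : 0 ≤ b)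
    (C : Set X) (hCmeas : MeasurableSet C) (hCsmall : IsSmallSet P C)
    (hWC : ∃ M : ℝ, ∀ x ∈ C, W x ≤ M)
    (hdrift : ∀ x, kernelExp ((kernelIter P (n x)) x) W
        ≤ ENNReal.ofReal (β * W x + b * Set.indicator C (fun _ => 1) x))
    (R : ℝ → ℝ) (hRmono : StrictMonoOn R (Set.Ioi 0))
    (hRpos : ∀ t : ℝ, 0 < t → 0 < R t)
    (hRrate : SubgeometricRate (fun k : ℕ => R k))
    (hRcase :
      ((∀ s t : ℝ, 0 < s → s ≤ t → R t / t ≤ R s / s) ∧ ∀ x, R (n x) ≤ W x) ∨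
      (ConvexOn ℝ (Set.Ioi 0) R ∧ Set.BijOn R (Set.Ioi 0) (Set.Ioi 0) ∧
        (∃ R' : ℝ → ℝ, ContinuousOn R' (Set.Ioi 0) ∧
          (∀ t ∈ Set.Ioi (0 : ℝ), HasDerivAt R (R' t) t) ∧
          (∀ t ∈ Set.Ioi (0 : ℝ), 0 < R' t) ∧
          ConcaveOn ℝ (Set.Ioi 0) (fun t => Real.log (R' t))) ∧
        (∃ Rinv : ℝ → ℝ,
          (∀ t ∈ Set.Ioi (0 : ℝ), Rinv (R t) = t ∧ R (Rinv t) = t) ∧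
          ∀ x, (n x : ℝ) ≤ Rinv (W x) - Rinv (β * W x))))
    (π : Measure X) (hπprob : IsProbabilityMeasure π)
    (hπinv : Kernel.Invariant P π)
    (hπuniq : ∀ π' : Measure X, IsProbabilityMeasure π' → Kernel.Invariant P π' → π' = π)
    (hπW : ∫⁻ x, ENNReal.ofReal (W x) ∂π ≠ ⊤) :
    ∃ D : Set X, MeasurableSet D ∧ Accessible P D ∧ IsSmallSet P D ∧
      ∃ M : ℝ, ∀ x ∈ D,
        (∑' k : ℕ, ENNReal.ofReal (R (k : ℝ)) * survival P D k x) ≤ ENNReal.ofReal M := by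
  obtain ⟨ε, ν, hε, hν, hminor⟩ := hCsmall
  have hdrift' : ∀ x, ∫⁻ y, ENNReal.ofReal (W y) ∂kernelIter P (n x) x ≤
      ENNReal.ofReal (β * W x + b * C.indicator (fun _ => 1) x) := hdrift
  have hacc : Accessible P C := accessible_of_drift hCmeas hW1 (n := n) hβ fun x hx => by
    simpa [hx] using hdrift' x
  obtain ⟨x₀, hx₀⟩ : C.Nonempty := by
    rw [nonempty_iff_ne_empty]
    rintro rfl
    obtain ⟨x⟩ := nonempty_of_isProbabilityMeasure π
    obtain ⟨k, -, hk⟩ := hacc x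
    simp at hk
  set μ : Measure X := ENNReal.ofReal ε • ν with hμdef
  have hμle : ∀ x ∈ C, μ ≤ P x := fun x hx => Measure.le_intro fun A hA _ => hminor x hx A hA
  have hμ0 : μ ≠ 0 := by
    intro h0
    refine hν (Measure.measure_univ_eq_zero.1 ?_)
    have := congrArg (fun m : Measure X => m univ) h0
    simpa [hμdef, hε.not_ge] using this
  have : IsFiniteMeasure μ := isFiniteMeasure_of_le (P x₀) (hμle x₀ hx₀)
  obtain ⟨K, hK⟩ := exists_residual_kernel hCmeas hμle
  have hKP := le_of_eq_add_indicator hK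
  have he0 : μ univ ≠ 0 := Measure.measure_univ_ne_zero.2 hμ0
  have hetop : μ univ ≠ ⊤ := measure_ne_top μ univ
  have he : ∀ x ∈ C, K x univ + μ univ ≤ 1 := fun x hx => by
    simpa [hx] using (residual_univ_add hK x).le
  obtain ⟨G, L, a, hL, hGr, hG, hGC, ha, hG0⟩ : ∃ (G : ℕ → X → ℝ≥0∞) (L a : ℝ≥0∞), L ≠ ⊤ ∧
      (∀ s x, positiveRate R s ≤ G s x) ∧
      (∀ s, ∀ x ∉ C, ∫⁻ y, G (s + n x) y ∂kernelIter P (n x) x ≤ G s x) ∧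
      (∀ s, ∀ x ∈ C, 2 * ∫⁻ y, G (s + n x) y ∂kernelIter P (n x) x ≤
        (2 + μ univ) * positiveRate R s + L) ∧
      a ≠ ⊤ ∧ ∀ x, G 0 x ≤ a * ENNReal.ofReal (W x) := by
    rcases hRcase with ⟨hRdiv, hRn⟩ | ⟨-, hbij, ⟨R', -, hR', hR'pos, hlog⟩, Rinv, hinv, hRn⟩
    · obtain ⟨G, L, hL, hGr, hG, hGC, hG0⟩ := exists_drift_of_antitone_div hW1 hn1 hβ hWC
        hdrift' hWmeas hRpos hRdiv hRn (μ univ)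
      exact ⟨G, L, _, hL, hGr, hG, hGC, ofReal_ne_top, hG0⟩
    · obtain ⟨G, L, hL, hGr, hG, hGC, hG0⟩ := exists_drift_of_logConcave_deriv hW1 hβ hb hWC
        hdrift' hWmeas hRmono hRpos hRrate hbij hR' hR'pos hlog hinv hRn he0 hetop
      exact ⟨G, L, 1, hL, hGr, hG, hGC, one_ne_top, by simpa using hG0⟩
  have hr := positiveRate_monotone hRrate.2.1
  have hr0 : positiveRate R 0 = 0 := by simp [positiveRate]
  have hrtop : ∀ k, positiveRate R k ≠ ⊤ := fun k =>
    ne_top_of_le_ne_top ofReal_ne_top (positiveRate_le R k)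
  have hmoment : ∀ x, ∑' m, (positiveRate R (m + 1) - positiveRate R m) * kernelIter K m x univ ≤
      2 * a * ENNReal.ofReal (W x) + L / μ univ := by
    intro x
    rw [ENNReal.tsum_eq_iSup_nat]
    refine iSup_le fun j => ?_
    have h := lifetimeMoment_le_of_drift hKP hr hrtop hn1 he0 hetop hL he hGr hG hGC j 0 x
    simp only [lifetimeMoment, hr0, zero_add] at h
    refine h.trans (add_le_add ?_ le_rfl)
    rw [mul_assoc]
    exact mul_le_mul' le_rfl (hG0 x)
  have hlife : ∑' k, positiveRate R (k + 1) * ∫⁻ y, kernelIter K k y univ ∂μ ≠ ⊤ := by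
    have hle := (mul_tsum_rate_le_lintegral hCmeas hK hπinv hr hr0).trans (lintegral_mono hmoment)
    rw [lintegral_add_right _ measurable_const, lintegral_const_mul _ hWmeas.ennreal_ofReal,
      lintegral_const, measure_univ (μ := π), mul_one] at hle
    have hfin := ne_top_of_le_ne_top (ENNReal.add_ne_top.2 ⟨ENNReal.mul_ne_top
      (ENNReal.mul_ne_top ofNat_ne_top ha) hπW, ENNReal.div_ne_top hL he0⟩) hle
    intro htop
    rw [htop, ENNReal.mul_top (hacc.measure_pos hCmeas (IsProbabilityMeasure.ne_zero π) hπinv)]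
      at hfin
    exact hfin rfl
  obtain ⟨ρ, hone, hmono, hsub, hratio, hequiv⟩ := hRrate.exists_submultiplicative
  have hρpos : ∀ k, 0 < ρ k := fun k => one_pos.trans_le (hone k)
  have hRsucc : ∀ k : ℕ, 0 < R (k + 1 : ℕ) := fun k => hRpos _ (by positivity)
  obtain ⟨c, hc, hcR⟩ := exists_le_mul_of_tendsto_div hρpos hequiv
  obtain ⟨d, hd, hdρ⟩ : ∃ d : ℝ, 0 < d ∧ ∀ k : ℕ, ρ (k + 1) ≤ d * R (k + 1 : ℕ) := by
    refine exists_le_mul_of_tendsto_div hRsucc (l := 1) ?_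
    have := ((tendsto_add_atTop_iff_nat 1).2 hequiv).inv₀ one_ne_zero
    simpa only [inv_div, inv_one] using this
  have hlifeρ : ∑' k, ENNReal.ofReal (ρ k) * ∫⁻ y, kernelIter K k y univ ∂μ ≠ ⊤ := by
    refine ne_top_of_le_ne_top (ENNReal.mul_ne_top (ofReal_ne_top (r := d)) hlife) ?_
    rw [← ENNReal.tsum_mul_left]
    refine ENNReal.tsum_le_tsum fun k => ?_
    rw [← mul_assoc, positiveRate, if_neg k.succ_ne_zero, ← ENNReal.ofReal_mul hd.le]
    exact mul_le_mul' (ENNReal.ofReal_le_ofReal ((hmono k.le_succ).trans (hdρ k))) le_rfl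
  obtain ⟨D, hDC, hD, hDacc, M, hMtop, hM⟩ :=
    exists_accessible_subset_of_lifetime hCmeas hacc hμ0 hK hone hsub hratio hlifeρ
  refine ⟨D, hD, hDacc, ⟨ε, ν, hε, hν, fun x hx => hminor x (hDC hx)⟩,
    c * M.toReal, fun x hx => ?_⟩
  rw [ENNReal.ofReal_mul hc.le, ENNReal.ofReal_toReal hMtop]
  refine le_trans ?_ (mul_le_mul' le_rfl (hM x hx))
  rw [← ENNReal.tsum_mul_left]
  refine ENNReal.tsum_le_tsum fun k => ?_
  rw [← mul_assoc, ← ENNReal.ofReal_mul hc.le]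
  exact mul_le_mul' (ENNReal.ofReal_le_ofReal (hcR k)) le_rfl
end

section
/- Fix β ∈ (0, e^{−1}) and κ > 0, and let Q be the Markov kernel on [κ,∞) defined by Q(z,A) := ∫_{A ∩ (max(βz,κ),∞)} (βz/y²) dy + max(0, 1 − βz/κ)·1_A(κ). Then the interval [κ, κ/β] is small for Q: for every z ∈ [κ, κ/β], Q(z,·) ≥ β·ν(·), where ν is the probability measure on [κ,∞) with density y ↦ κ/y² on (κ,∞) with respect to Lebesgue measure. -/
open MeasureTheory ProbabilityTheory ENNReal Set Filter

variable {X : Type*} [MeasurableSpace X]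

/-- The transition kernel `Q` (as a family of measures) of the chain `Y = κ exp(U)`:
`Q(z,A) = ∫_{A ∩ (max(βz,κ),∞)} (βz/y²) dy + max(0, 1 - βz/κ) 1_A(κ)`. -/
noncomputable def Qmeas (β κ z : ℝ) : Measure ℝ :=
  (volume.restrict (Set.Ioi (max (β * z) κ))).withDensity
      (fun y => ENNReal.ofReal (β * z / y ^ 2))
    + (ENNReal.ofReal (max 0 (1 - β * z / κ))) • Measure.dirac κ

/-- The Pareto density `y ↦ κ / y ^ 2` has total mass one on `(κ, ∞)`. -/
lemma withDensity_div_sq_univ {κ : ℝ} (hκ : 0 < κ) :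
    ((volume.restrict (Set.Ioi κ)).withDensity fun y => ENNReal.ofReal (κ / y ^ 2))
      Set.univ = 1 := by
  have hrpow : ∀ y ∈ Set.Ioi κ, κ * y ^ (-2 : ℝ) = κ / y ^ 2 := fun y hy => by
    rw [Real.rpow_neg (hκ.trans hy).le, Real.rpow_two, div_eq_mul_inv]
  have hint : IntegrableOn (fun y : ℝ => κ / y ^ 2) (Set.Ioi κ) :=
    IntegrableOn.congr_fun
      ((integrableOn_Ioi_rpow_of_lt (by norm_num : (-2 : ℝ) < -1) hκ).const_mul κ)
      hrpow measurableSet_Ioi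
  have hval : ∫ y in Set.Ioi κ, κ / y ^ 2 = 1 := by
    rw [← setIntegral_congr_fun measurableSet_Ioi hrpow, integral_const_mul,
      integral_Ioi_rpow_of_lt (by norm_num) hκ]
    norm_num [Real.rpow_neg_one, hκ.ne']
  rw [withDensity_apply _ MeasurableSet.univ, Measure.restrict_univ,
    ← ofReal_integral_eq_lintegral_ofReal hint (.of_forall fun y => by positivity), hval,
    ENNReal.ofReal_one]

/-- The interval `[κ, κ/β]` is small for `Q`: for `z ∈ [κ, κ/β]`,
`Q(z,·) ≥ β ν(·)` where `ν` is the probability measure with density `y ↦ κ/y²`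
on `(κ,∞)`. -/
theorem statement14 (β κ : ℝ) (hβ : β ∈ Set.Ioo 0 (Real.exp (-1))) (hκ : 0 < κ) :
    IsProbabilityMeasure
      ((volume.restrict (Set.Ioi κ)).withDensity fun y => ENNReal.ofReal (κ / y ^ 2)) ∧
    ∀ z ∈ Set.Icc κ (κ / β), ∀ A : Set ℝ, MeasurableSet A →
      ENNReal.ofReal β *
          ((volume.restrict (Set.Ioi κ)).withDensity fun y => ENNReal.ofReal (κ / y ^ 2)) A
        ≤ Qmeas β κ z A := by
  refine ⟨⟨withDensity_div_sq_univ hκ⟩, fun z hz A hA => ?_⟩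
  have hmax : max (β * z) κ = κ :=
    max_eq_right (by simpa [mul_comm] using (le_div_iff₀ hβ.1).1 hz.2)
  rw [Qmeas, hmax, Measure.add_apply, withDensity_apply _ hA, withDensity_apply _ hA,
    ← lintegral_const_mul _ (by fun_prop)]
  refine le_add_right (lintegral_mono fun y => ?_)
  rw [← ENNReal.ofReal_mul hβ.1.le, ← mul_div_assoc]
  have hβ0 := hβ.1.le
  have hzκ := hz.1
  gcongr
end

section
/- Fix β ∈ (0, e^{−1}) and κ > 0, and let Q be the Markov kernel on [κ,∞) defined by Q(z,A) := ∫_{A ∩ (max(βz,κ),∞)} (βz/y²) dy + max(0, 1 − βz/κ)·1_A(κ). Let α ∈ (0,1). Then: (a) for every z ≥ κ/β, ∫ y^α Q(z,dy) = (β^α/(1−α))·z^α; (b) for every z ∈ [κ, κ/β], ∫ y^α Q(z,dy) ≤ (β^α/(1−α))·z^α + ((1−β^α)/(1−α))·κ^α; and (c) if additionally α ln β < ln(1−α), then β^α/(1−α) < 1, so that Q satisfies the geometric drift condition ∫ y^α Q(z,dy) ≤ β'·z^α + b'·1_{[κ,κ/β]}(z) for all z ≥ κ, with β' := β^α/(1−α)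 ∈ (0,1) and b' := ((1−β^α)/(1−α))·κ^α. -/
open MeasureTheory ProbabilityTheory ENNReal Set Filter

variable {X : Type*} [MeasurableSpace X]

lemma lintegral_rpow_Qmeas {β κ z α : ℝ} (hκ : 0 < κ) (hβz : 0 < β * z) (hα : α < 1) :
    ∫⁻ y, ENNReal.ofReal (y ^ α) ∂(Qmeas β κ z)
      = ENNReal.ofReal (β * z * (max (β * z) κ) ^ (α - 1) / (1 - α)
          + max 0 (1 - β * z / κ) * κ ^ α) := by
  have hc : 0 < max (β * z) κ := lt_max_of_lt_right hκ
  have hexp : α - 2 < -1 := by linarith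
  have hpow : ∀ y : ℝ, 0 < y → β * z / y ^ 2 * y ^ α = β * z * y ^ (α - 2) := by
    intro y hy
    rw [Real.rpow_sub hy, Real.rpow_two]
    ring
  have hcont : ∫⁻ y in Ioi (max (β * z) κ),
      ENNReal.ofReal (β * z / y ^ 2) * ENNReal.ofReal (y ^ α)
        = ENNReal.ofReal (β * z * (max (β * z) κ) ^ (α - 1) / (1 - α)) := by
    have hcongr : ∫⁻ y in Ioi (max (β * z) κ),
        ENNReal.ofReal (β * z / y ^ 2) * ENNReal.ofReal (y ^ α)
          = ∫⁻ y in Ioi (max (β * z) κ), ENNReal.ofReal (β * z * y ^ (α - 2)) := by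
      refine setLIntegral_congr_fun measurableSet_Ioi fun y hy => ?_
      have hy0 : 0 < y := hc.trans hy
      change ENNReal.ofReal _ * ENNReal.ofReal _ = ENNReal.ofReal _
      rw [← ENNReal.ofReal_mul (by positivity), hpow y hy0]
    rw [hcongr, ← ofReal_integral_eq_lintegral_ofReal
      ((integrableOn_Ioi_rpow_of_lt hexp hc).const_mul _)]
    · rw [integral_const_mul, integral_Ioi_rpow_of_lt hexp hc,
        show α - 2 + 1 = -(1 - α) by ring, neg_div_neg_eq, mul_div_assoc, neg_sub]
    · filter_upwards [ae_restrict_mem measurableSet_Ioi] with y hy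
      have hy0 : 0 < y := hc.trans hy
      change 0 ≤ β * z * y ^ (α - 2)
      positivity
  have hα' : 0 < 1 - α := by linarith
  rw [Qmeas, lintegral_add_measure, lintegral_smul_measure, lintegral_dirac,
    lintegral_withDensity_eq_lintegral_mul _ (by fun_prop) (by fun_prop), smul_eq_mul,
    ← ENNReal.ofReal_mul (le_max_left _ _), ENNReal.ofReal_add (by positivity) (by positivity)]
  exact congrArg (· + _) hcont

/-- drift computation in the proof of Proposition `tame-domination`.
Moments of `y ↦ y^α` under `Q(z,·)`: exact value off `[κ,κ/β]`, a bound on `[κ,κ/β]`, and the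
resulting geometric drift condition when `α ln β < ln(1-α)`. -/
theorem statement15 (β κ : ℝ) (hβ : β ∈ Set.Ioo 0 (Real.exp (-1))) (hκ : 0 < κ)
    (α : ℝ) (hα : α ∈ Set.Ioo (0 : ℝ) 1) :
    (∀ z : ℝ, κ / β ≤ z →
      ∫⁻ y, ENNReal.ofReal (y ^ α) ∂(Qmeas β κ z)
        = ENNReal.ofReal (β ^ α / (1 - α) * z ^ α)) ∧
    (∀ z ∈ Set.Icc κ (κ / β),
      ∫⁻ y, ENNReal.ofReal (y ^ α) ∂(Qmeas β κ z)
        ≤ ENNReal.ofReal (β ^ α / (1 - α) * z ^ α + (1 - β ^ α) / (1 - α) * κ ^ α)) ∧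
    (α * Real.log β < Real.log (1 - α) →
      β ^ α / (1 - α) < 1 ∧
      ∀ z : ℝ, κ ≤ z →
        ∫⁻ y, ENNReal.ofReal (y ^ α) ∂(Qmeas β κ z)
          ≤ ENNReal.ofReal (β ^ α / (1 - α) * z ^ α +
              (1 - β ^ α) / (1 - α) * κ ^ α *
                Set.indicator (Set.Icc κ (κ / β)) (fun _ => 1) z)) := by
  obtain ⟨hβ0, hβe⟩ := hβ
  obtain ⟨hα0, hα1⟩ := hα
  have hα' : 0 < 1 - α := by linarith
  have hexact : ∀ z : ℝ, κ / β ≤ z →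
      ∫⁻ y, ENNReal.ofReal (y ^ α) ∂(Qmeas β κ z)
        = ENNReal.ofReal (β ^ α / (1 - α) * z ^ α) := by
    intro z hz
    have hz0 : 0 < z := (div_pos hκ hβ0).trans_le hz
    have hβz : 0 < β * z := mul_pos hβ0 hz0
    have hκz : κ ≤ β * z := by rwa [div_le_iff₀' hβ0] at hz
    have hatom : 1 - β * z / κ ≤ 0 := by
      rw [sub_nonpos, one_le_div hκ]
      exact hκz
    rw [lintegral_rpow_Qmeas hκ hβz hα1, max_eq_left hκz, max_eq_left hatom, zero_mul, add_zero,
      Real.rpow_sub_one hβz.ne', mul_div_cancel₀ _ hβz.ne', Real.mul_rpow hβ0.le hz0.le]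
    ring_nf
  have hbound : ∀ z ∈ Set.Icc κ (κ / β),
      ∫⁻ y, ENNReal.ofReal (y ^ α) ∂(Qmeas β κ z)
        ≤ ENNReal.ofReal (β ^ α / (1 - α) * z ^ α + (1 - β ^ α) / (1 - α) * κ ^ α) := by
    rintro z ⟨hκz, hz⟩
    have hz0 : 0 < z := hκ.trans_le hκz
    have hβz : 0 < β * z := mul_pos hβ0 hz0
    have hzκ : β * z ≤ κ := by rwa [le_div_iff₀' hβ0] at hz
    have ht : β * z / κ ≤ 1 := (div_le_one hκ).2 hzκ
    have hβκ : β ^ α * κ ^ α ≤ β ^ α * z ^ α := by gcongr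
    have hκα : 0 < κ ^ α := Real.rpow_pos_of_pos hκ α
    rw [lintegral_rpow_Qmeas hκ hβz hα1, max_eq_right hzκ, max_eq_right (sub_nonneg.2 ht),
      Real.rpow_sub_one hκ.ne']
    refine ENNReal.ofReal_le_ofReal ?_
    have hlhs : β * z * (κ ^ α / κ) / (1 - α) + (1 - β * z / κ) * κ ^ α
        = (1 - α + α * (β * z / κ)) * κ ^ α / (1 - α) := by
      field_simp
      ring
    have hrhs : β ^ α / (1 - α) * z ^ α + (1 - β ^ α) / (1 - α) * κ ^ α
        = (κ ^ α + (β ^ α * z ^ α - β ^ α * κ ^ α)) / (1 - α) := by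
      ring
    rw [hlhs, hrhs]
    gcongr
    have hcoef : 1 - α + α * (β * z / κ) ≤ 1 := by nlinarith
    nlinarith [mul_le_mul_of_nonneg_right hcoef hκα.le]
  refine ⟨hexact, hbound, fun hlog => ⟨?_, fun z hz => ?_⟩⟩
  · rw [div_lt_one hα', ← Real.log_lt_log_iff (Real.rpow_pos_of_pos hβ0 α) hα',
      Real.log_rpow hβ0]
    exact hlog
  · by_cases hmem : z ∈ Set.Icc κ (κ / β)
    · rw [Set.indicator_of_mem hmem, mul_one]
      exact hbound z hmem
    · have hlt : κ / β < z := by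
        by_contra! h
        exact hmem ⟨hz, h⟩
      rw [Set.indicator_of_notMem hmem, mul_zero, add_zero]
      exact (hexact z hlt.le).le
end

section
/- Let P be phi-irreducible and aperiodic, and assume there exist a small set C, constants c > 0, b < ∞, α ∈ (0,1), and a measurable function V : X → [1,∞) with sup_{x∈C} V(x) < ∞ such that P V(x) ≤ V(x) − c·V(x)^{1−α} + b·1_C(x) for all x ∈ X. Then there exists a constant C' < ∞ such that 𝔼_x[τ_C^{1/α}] ≤ C'·V(x) for all x ∈ X. -/
open MeasureTheory ProbabilityTheory ENNReal Set Filter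

variable {X : Type*} [MeasurableSpace X]

/-- Tangent-line bound for the concave function `v ↦ (v ^ α + s) ^ (1 / α)`. -/
lemma rpow_add_rpow_inv_le_tangent {α s v w : ℝ} (hα : α ∈ Set.Ioo (0 : ℝ) 1) (hs : 0 ≤ s)
    (hv : 0 < v) (hw : 0 ≤ w) :
    (w ^ α + s) ^ (1 / α) + (v ^ α + s) ^ (1 / α - 1) * v ^ (α - 1) * v
      ≤ (v ^ α + s) ^ (1 / α) + (v ^ α + s) ^ (1 / α - 1) * v ^ (α - 1) * w := by
  obtain ⟨hα0, hα1⟩ := hα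
  have hvα : 0 < v ^ α := Real.rpow_pos_of_pos hv α
  set t := v ^ α + s with ht
  have htpos : 0 < t := by positivity
  have hp : 1 ≤ 1 / α := by rw [le_div_iff₀ hα0]; linarith
  have hr : 0 ≤ w / v := by positivity
  have hjensen := (convexOn_rpow hp).2
    (show (w / v) ^ α ∈ Set.Ici 0 from Real.rpow_nonneg hr α)
    (Set.mem_Ici.2 (zero_le_one (α := ℝ)))
    (show 0 ≤ v ^ α / t by positivity) (show 0 ≤ s / t by positivity)
    (by rw [← add_div, ← ht, div_self htpos.ne'])
  simp only [smul_eq_mul] at hjensen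
  rw [← Real.rpow_mul hr, mul_one_div_cancel hα0.ne', Real.rpow_one, Real.one_rpow] at hjensen
  have hfactor : w ^ α + s = t * (v ^ α / t * (w / v) ^ α + s / t * 1) := by
    rw [Real.div_rpow hw hv.le]
    field_simp
  have hpow : t ^ (1 / α) = t ^ (1 / α - 1) * t := by
    rw [Real.rpow_sub_one htpos.ne']
    field_simp
  have hslope : v ^ (α - 1) = v ^ α / v := Real.rpow_sub_one hv.ne' α
  have hmul := mul_le_mul_of_nonneg_left hjensen (Real.rpow_nonneg htpos.le (1 / α))
  rw [← Real.mul_rpow htpos.le (by positivity), ← hfactor] at hmul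
  have hexpand : t ^ (1 / α) * (v ^ α / t * (w / v) + s / t * 1)
      = t ^ (1 / α) + t ^ (1 / α - 1) * v ^ (α - 1) * w - t ^ (1 / α - 1) * v ^ (α - 1) * v := by
    rw [hpow, hslope]
    have hs' : s = t - v ^ α := by rw [ht]; ring
    rw [hs']
    field_simp
    ring
  linarith

/-- Bernoulli's inequality in the form `t ^ p - p δ t ^ (p - 1) ≤ (t - δ) ^ p`. -/
lemma rpow_sub_mul_le_rpow_sub {p t δ : ℝ} (hp : 1 ≤ p) (ht : 0 < t) (hδ : δ ≤ t) :
    t ^ p - p * δ * t ^ (p - 1) ≤ (t - δ) ^ p := by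
  have hle : -1 ≤ -(δ / t) := by
    rw [neg_le_neg_iff, div_le_one ht]; exact hδ
  have hbern := one_add_mul_self_le_rpow_one_add hle hp
  have hmul := mul_le_mul_of_nonneg_left hbern (Real.rpow_nonneg ht.le p)
  rw [← Real.mul_rpow ht.le (by linarith)] at hmul
  have hbase : t * (1 + -(δ / t)) = t - δ := by field_simp; ring
  rw [hbase] at hmul
  rw [Real.rpow_sub_one ht.ne']
  calc t ^ p - p * δ * (t ^ p / t) = t ^ p * (1 + p * -(δ / t)) := by field_simp; ring
    _ ≤ _ := hmul

/-- Off `C`, the polynomial drift makes `(V ^ α + δ k) ^ (1 / α)`, with `δ = α c`, a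
supermartingale in space-time. -/
lemma lintegral_rpow_succ_le_of_drift {μ : Measure X} [IsProbabilityMeasure μ] {c α s v : ℝ}
    (hc : 0 < c) (hα : α ∈ Set.Ioo (0 : ℝ) 1) (hs : 0 ≤ s) {V : X → ℝ} (hVmeas : Measurable V)
    (hV : ∀ y, 0 ≤ V y) (hv : 0 < v)
    (hdrift : kernelExp μ V + ENNReal.ofReal (c * v ^ (1 - α)) ≤ ENNReal.ofReal v) :
    ∫⁻ y, ENNReal.ofReal ((V y ^ α + (s + α * c)) ^ (1 / α)) ∂μ
      ≤ ENNReal.ofReal ((v ^ α + s) ^ (1 / α)) := by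
  have hα0 := hα.1
  have hα1 := hα.2
  have hp : 1 ≤ 1 / α := by rw [le_div_iff₀ hα0]; linarith
  have hvα : 0 < v ^ α := Real.rpow_pos_of_pos hv α
  have hδ : 0 < α * c := mul_pos hα0 hc
  set t := v ^ α + (s + α * c) with ht
  have htpos : 0 < t := by positivity
  set κ := t ^ (1 / α - 1) * v ^ (α - 1) with hκ
  have hκ0 : 0 ≤ κ := by positivity
  have htangent : ∀ y, ENNReal.ofReal ((V y ^ α + (s + α * c)) ^ (1 / α)) + ENNReal.ofReal (κ * v)
      ≤ ENNReal.ofReal (t ^ (1 / α)) + ENNReal.ofReal κ * ENNReal.ofReal (V y) := by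
    intro y
    have hy := hV y
    rw [← ENNReal.ofReal_mul hκ0, ← ENNReal.ofReal_add (by positivity) (by positivity),
      ← ENNReal.ofReal_add (by positivity) (by positivity)]
    exact ENNReal.ofReal_le_ofReal
      (rpow_add_rpow_inv_le_tangent hα (by positivity) hv (hV y))
  have hint := lintegral_mono (μ := μ) htangent
  rw [lintegral_add_right _ measurable_const, lintegral_add_left measurable_const,
    lintegral_const_mul _ hVmeas.ennreal_ofReal] at hint
  simp only [lintegral_const, measure_univ, mul_one] at hint
  have hcancel : κ * (c * v ^ (1 - α)) = c * t ^ (1 / α - 1) := by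
    have hone : v ^ (α - 1) * v ^ (1 - α) = 1 := by
      rw [← Real.rpow_add hv]; simp
    calc κ * (c * v ^ (1 - α)) = c * t ^ (1 / α - 1) * (v ^ (α - 1) * v ^ (1 - α)) := by
          rw [hκ]; ring
      _ = _ := by rw [hone, mul_one]
  have hbern := rpow_sub_mul_le_rpow_sub hp htpos (δ := α * c) (by linarith)
  have hbase : t - α * c = v ^ α + s := by rw [ht]; ring
  have hpδ : 1 / α * (α * c) = c := by field_simp
  rw [hbase, hpδ] at hbern
  have hsum : ∫⁻ y, ENNReal.ofReal ((V y ^ α + (s + α * c)) ^ (1 / α)) ∂μ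
      + ENNReal.ofReal (κ * v + c * t ^ (1 / α - 1)) ≤ ENNReal.ofReal (t ^ (1 / α) + κ * v) := by
    rw [← hcancel, ENNReal.ofReal_add (by positivity) (by positivity), ← add_assoc]
    calc _ ≤ ENNReal.ofReal (t ^ (1 / α)) + ENNReal.ofReal κ * kernelExp μ V
          + ENNReal.ofReal (κ * (c * v ^ (1 - α))) := by gcongr ?_ + _; exact hint
      _ = ENNReal.ofReal (t ^ (1 / α))
          + ENNReal.ofReal κ * (kernelExp μ V + ENNReal.ofReal (c * v ^ (1 - α))) := by
        rw [ENNReal.ofReal_mul hκ0, mul_add, add_assoc]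
      _ ≤ ENNReal.ofReal (t ^ (1 / α)) + ENNReal.ofReal κ * ENNReal.ofReal v := by gcongr
      _ = _ := by rw [ENNReal.ofReal_add (by positivity) (by positivity), ENNReal.ofReal_mul hκ0]
  calc _ ≤ ENNReal.ofReal (t ^ (1 / α) + κ * v) - ENNReal.ofReal (κ * v + c * t ^ (1 / α - 1)) :=
        ENNReal.le_sub_of_add_le_right ENNReal.ofReal_ne_top hsum
    _ = ENNReal.ofReal (t ^ (1 / α) + κ * v - (κ * v + c * t ^ (1 / α - 1))) :=
        (ENNReal.ofReal_sub _ (by positivity)).symm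
    _ ≤ _ := ENNReal.ofReal_le_ofReal (by linarith)

/-- `firstReturn P C n x = ℙₓ(τ_C = n + 1)`. -/
noncomputable def firstReturn (P : Kernel X X) (C : Set X) : ℕ → X → ℝ≥0∞ :=
  retTaboo P C (fun x => P x C)

lemma measurable_retTaboo (P : Kernel X X) [IsMarkovKernel P] {C : Set X} (hC : MeasurableSet C)
    {f : X → ℝ≥0∞} (hf : Measurable f) (n : ℕ) : Measurable (retTaboo P C f n) := by
  induction n with
  | zero => exact hf
  | succ n ih => exact (ih.indicator hC.compl).lintegral_kernel

lemma survival_le_one (P : Kernel X X) [IsMarkovKernel P] (C : Set X) (n : ℕ) (x : X) :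
    survival P C n x ≤ 1 := by
  induction n generalizing x with
  | zero => exact le_rfl
  | succ n ih =>
    calc survival P C (n + 1) x = ∫⁻ y, Cᶜ.indicator (survival P C n) y ∂(P x) := rfl
      _ ≤ ∫⁻ _, 1 ∂(P x) := lintegral_mono fun y =>
          (indicator_le_self _ _ y).trans (ih y)
      _ = 1 := by simp

lemma firstReturn_add_survival_succ (P : Kernel X X) [IsMarkovKernel P] {C : Set X}
    (hC : MeasurableSet C) (n : ℕ) (x : X) :
    firstReturn P C n x + survival P C (n + 1) x = survival P C n x := by
  induction n generalizing x with
  | zero =>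
    calc P x C + ∫⁻ y, Cᶜ.indicator (fun _ => 1) y ∂(P x) = P x C + P x Cᶜ := by
          rw [lintegral_indicator hC.compl]; simp
      _ = 1 := by rw [measure_add_measure_compl hC, measure_univ]
  | succ n ih =>
    have hmeas : Measurable (Cᶜ.indicator (firstReturn P C n)) :=
      (measurable_retTaboo P hC (P.measurable_coe hC) n).indicator hC.compl
    calc (∫⁻ y, Cᶜ.indicator (firstReturn P C n) y ∂(P x))
          + ∫⁻ y, Cᶜ.indicator (survival P C (n + 1)) y ∂(P x)
        = ∫⁻ y, Cᶜ.indicator (firstReturn P C n) y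
            + Cᶜ.indicator (survival P C (n + 1)) y ∂(P x) := (lintegral_add_left hmeas _).symm
      _ = ∫⁻ y, Cᶜ.indicator (survival P C n) y ∂(P x) := by
          refine lintegral_congr fun y => ?_
          by_cases hy : y ∈ Cᶜ
          · simp only [indicator_of_mem hy, ih]
          · simp only [indicator_of_notMem hy, add_zero]

lemma survival_sub_survival_succ (P : Kernel X X) [IsMarkovKernel P] {C : Set X}
    (hC : MeasurableSet C) (n : ℕ) (x : X) :
    survival P C n x - survival P C (n + 1) x = firstReturn P C n x := by
  rw [← firstReturn_add_survival_succ P hC n x]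
  exact ENNReal.add_sub_cancel_right
    ((survival_le_one P C (n + 1) x).trans_lt ENNReal.one_lt_top).ne

/-- `truncReturn P C R k N x = 𝔼ₓ[R(k + min(τ_C, N))]`. -/
noncomputable def truncReturn (P : Kernel X X) (C : Set X) (R : ℕ → ℝ≥0∞) (k N : ℕ) (x : X) :
    ℝ≥0∞ :=
  (∑ n ∈ Finset.range N, R (k + n + 1) * firstReturn P C n x) + R (k + N) * survival P C N x

/-- First-step decomposition of the truncated return functional. -/
lemma truncReturn_succ (P : Kernel X X) [IsMarkovKernel P] {C : Set X} (hC : MeasurableSet C)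
    (R : ℕ → ℝ≥0∞) (k N : ℕ) (x : X) :
    truncReturn P C R k (N + 1) x
      = R (k + 1) * P x C + ∫⁻ y in Cᶜ, truncReturn P C R (k + 1) N y ∂(P x) := by
  have hfirst (n : ℕ) : Measurable (firstReturn P C n) :=
    measurable_retTaboo P hC (P.measurable_coe hC) n
  have hsurv (n : ℕ) : Measurable (survival P C n) := measurable_retTaboo P hC measurable_const n
  have hfirst_succ (n : ℕ) : firstReturn P C (n + 1) x = ∫⁻ y in Cᶜ, firstReturn P C n y ∂(P x) :=
    lintegral_indicator hC.compl _
  have hsurv_succ : survival P C (N + 1) x = ∫⁻ y in Cᶜ, survival P C N y ∂(P x) :=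
    lintegral_indicator hC.compl _
  have hzero : firstReturn P C 0 x = P x C := rfl
  unfold truncReturn
  rw [lintegral_add_right _ ((hsurv N).const_mul _),
    lintegral_finsetSum _ fun n _ => (hfirst n).const_mul _,
    lintegral_const_mul _ (hsurv N), ← hsurv_succ, Finset.sum_range_succ', hzero]
  simp only [lintegral_const_mul _ (hfirst _), ← hfirst_succ]
  rw [add_right_comm, add_comm]
  congr 2
  · refine Finset.sum_congr rfl fun n _ => ?_
    congr 2
    ring
  · congr 2
    ring

/-- A space-time function dominating `R` bounds the return functional after the first step,
provided it is a supermartingale off `C`. -/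
lemma truncReturn_succ_le_lintegral (P : Kernel X X) [IsMarkovKernel P] {C : Set X}
    (hC : MeasurableSet C) {R : ℕ → ℝ≥0∞} {g : ℕ → X → ℝ≥0∞} (hR : ∀ k x, R k ≤ g k x)
    (hsuper : ∀ k, ∀ x ∉ C, ∫⁻ y, g (k + 1) y ∂(P x) ≤ g k x) (k N : ℕ) (x : X) :
    truncReturn P C R k (N + 1) x ≤ ∫⁻ y, g (k + 1) y ∂(P x) := by
  have hstep (k N : ℕ) (x : X) (hN : ∀ y ∉ C, truncReturn P C R (k + 1) N y ≤ g (k + 1) y) :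
      truncReturn P C R k (N + 1) x ≤ ∫⁻ y, g (k + 1) y ∂(P x) := by
    rw [truncReturn_succ P hC, ← lintegral_add_compl (g (k + 1)) hC]
    gcongr ?_ + ?_
    · calc R (k + 1) * P x C = ∫⁻ _ in C, R (k + 1) ∂(P x) := by simp
        _ ≤ _ := lintegral_mono fun y => hR (k + 1) y
    · exact setLIntegral_mono' hC.compl hN
  have hoff : ∀ N k, ∀ y ∉ C, truncReturn P C R k N y ≤ g k y := by
    intro N
    induction N with
    | zero =>
      intro k y _
      simpa [truncReturn, survival, retTaboo] using hR k y
    | succ N ih => exact fun k y hy => (hstep k N y (ih (k + 1))).trans (hsuper k y hy)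
  exact hstep k N x (hoff N (k + 1))

/-- Uniform control of the truncated functionals controls `𝔼ₓ[R(τ_C)]`. -/
lemma expReturn_le_two_mul (P : Kernel X X) [IsMarkovKernel P] {C : Set X}
    (hC : MeasurableSet C) {R : ℕ → ℝ≥0∞} {x : X} {B : ℝ≥0∞}
    (hB : ∀ N, truncReturn P C R 0 (N + 1) x ≤ B) : expReturn P C R x ≤ 2 * B := by
  unfold expReturn
  rw [two_mul]
  simp only [survival_sub_survival_succ P hC]
  gcongr ?_ + ?_
  · refine ENNReal.tsum_le_of_sum_range_le fun N => ?_
    calc _ ≤ ∑ n ∈ Finset.range (N + 1), R (n + 1) * firstReturn P C n x :=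
          Finset.sum_le_sum_of_subset (Finset.range_subset_range.2 N.le_succ)
      _ ≤ truncReturn P C R 0 (N + 1) x := by simp [truncReturn]
      _ ≤ B := hB N
  · rw [ENNReal.iSup_mul]
    refine iSup_le fun N => ?_
    calc _ ≤ R (N + 1) * survival P C (N + 1) x := by gcongr; exact iInf_le _ _
      _ ≤ truncReturn P C R 0 (N + 1) x := by simp [truncReturn]
      _ ≤ B := hB N

/-- polynomial drift example after Corollary `Pi-integ`.  For a
phi-irreducible aperiodic kernel satisfying the polynomial drift condition
`PV ≤ V - c V^{1-α} + b 1_C` with `C` small and `sup_C V < ∞`, one has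
`𝔼ₓ[τ_C^{1/α}] ≤ C' V(x)`. -/
theorem statement19
    (P : Kernel X X) [IsMarkovKernel P]
    (hirr : KIrreducible P) (hap : KAperiodic P)
    (C : Set X) (hCmeas : MeasurableSet C) (hCsmall : IsSmallSet P C)
    (c b α : ℝ) (hc : 0 < c) (hb : 0 ≤ b) (hα : α ∈ Set.Ioo (0 : ℝ) 1)
    (V : X → ℝ) (hVmeas : Measurable V) (hV1 : ∀ x, 1 ≤ V x)
    (hVC : ∃ M : ℝ, ∀ x ∈ C, V x ≤ M)
    (hdrift : ∀ x, kernelExp (P x) V + ENNReal.ofReal (c * V x ^ (1 - α))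
        ≤ ENNReal.ofReal (V x + b * Set.indicator C (fun _ => 1) x)) :
    ∃ C' : ℝ, 0 ≤ C' ∧ ∀ x,
      expReturn P C (fun k : ℕ => ENNReal.ofReal ((k : ℝ) ^ (1 / α))) x
        ≤ ENNReal.ofReal (C' * V x) := by
  have hα0 := hα.1
  have hδ : 0 < α * c := mul_pos hα0 hc
  have hV0 : ∀ y, 0 < V y := fun y => zero_lt_one.trans_le (hV1 y)
  set L := ((α * c) ^ (1 / α))⁻¹ with hL
  have hL0 : 0 ≤ L := by positivity
  set K := (1 + α * c) ^ (1 / α) with hK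
  have hK0 : 0 ≤ K := by positivity
  let g : ℕ → X → ℝ≥0∞ := fun k y =>
    ENNReal.ofReal L * ENNReal.ofReal ((V y ^ α + α * c * k) ^ (1 / α))
  have hgmeas (k : ℕ) :
      Measurable fun y => ENNReal.ofReal ((V y ^ α + α * c * k) ^ (1 / α)) :=
    (((hVmeas.pow_const α).add_const _).pow_const _).ennreal_ofReal
  have hR : ∀ (k : ℕ) (y : X), ENNReal.ofReal ((k : ℝ) ^ (1 / α)) ≤ g k y := by
    intro k y
    have hVα : 0 ≤ V y ^ α := Real.rpow_nonneg (hV0 y).le α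
    have hscale : (k : ℝ) ^ (1 / α) = L * (α * c * k) ^ (1 / α) := by
      rw [Real.mul_rpow hδ.le k.cast_nonneg, hL, inv_mul_cancel_left₀ (by positivity)]
    simp only [g]
    rw [← ENNReal.ofReal_mul hL0, hscale]
    refine ENNReal.ofReal_le_ofReal (mul_le_mul_of_nonneg_left ?_ hL0)
    exact Real.rpow_le_rpow (by positivity) (by linarith) (by positivity)
  have hsuper : ∀ k, ∀ x ∉ C, ∫⁻ y, g (k + 1) y ∂(P x) ≤ g k x := by
    intro k x hx
    have hdx := hdrift x
    rw [indicator_of_notMem hx, mul_zero, add_zero] at hdx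
    simp only [g]
    rw [lintegral_const_mul _ (hgmeas (k + 1))]
    gcongr
    simp only [Nat.cast_succ, mul_add_one]
    exact lintegral_rpow_succ_le_of_drift (s := α * c * k) hc hα (by positivity) hVmeas
      (fun y => (hV0 y).le) (hV0 x) hdx
  have hfirst : ∀ x, ∫⁻ y, g 1 y ∂(P x) ≤ ENNReal.ofReal (L * K * (1 + b) * V x) := by
    intro x
    have hpoint : ∀ y, g 1 y ≤ ENNReal.ofReal (L * K) * ENNReal.ofReal (V y) := by
      intro y
      have hVα : 1 ≤ V y ^ α := Real.one_le_rpow (hV1 y) hα0.le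
      simp only [g]
      rw [ENNReal.ofReal_mul hL0, mul_assoc (ENNReal.ofReal L), ← ENNReal.ofReal_mul hK0]
      gcongr
      calc (V y ^ α + α * c * (1 : ℕ)) ^ (1 / α)
          ≤ ((1 + α * c) * V y ^ α) ^ (1 / α) := by
            refine Real.rpow_le_rpow (by positivity) ?_ (by positivity)
            push_cast
            nlinarith
        _ = K * V y := by
            rw [Real.mul_rpow (by positivity) (by positivity), ← Real.rpow_mul (hV0 y).le,
              mul_one_div_cancel hα0.ne', Real.rpow_one]
    have hind : Set.indicator C (fun _ => (1 : ℝ)) x ≤ 1 :=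
      indicator_le_self' (fun _ _ => zero_le_one) x
    calc ∫⁻ y, g 1 y ∂(P x) ≤ ∫⁻ y, ENNReal.ofReal (L * K) * ENNReal.ofReal (V y) ∂(P x) :=
          lintegral_mono hpoint
      _ = ENNReal.ofReal (L * K) * kernelExp (P x) V :=
          lintegral_const_mul _ hVmeas.ennreal_ofReal
      _ ≤ ENNReal.ofReal (L * K) * ENNReal.ofReal ((1 + b) * V x) := by
          gcongr
          refine (le_self_add.trans (hdrift x)).trans (ENNReal.ofReal_le_ofReal ?_)
          nlinarith [hV1 x, mul_le_mul_of_nonneg_left hind hb,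
            mul_le_mul_of_nonneg_left (hV1 x) hb]
      _ = _ := by rw [← ENNReal.ofReal_mul (by positivity)]; ring_nf
  refine ⟨2 * (L * K * (1 + b)), by positivity, fun x => ?_⟩
  refine (expReturn_le_two_mul P hCmeas fun N =>
    (truncReturn_succ_le_lintegral P hCmeas hR hsuper 0 N x).trans (hfirst x)).trans_eq ?_
  rw [mul_assoc 2, ENNReal.ofReal_mul zero_le_two, ENNReal.ofReal_ofNat]
end
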